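/- Let q be a prime power with q ≡ 3 (mod 4) and q ≥ 7, of characteristic p, let n be an integer with 3 ≤ n ≤ p, and let e be an even divisor of q−1. If Rad(e) = Rad(q−1) set s = 0 and δ = 1; otherwise let p_1, …, p_s (s ≥ 1) be the distinct primes dividing q−1 but not e and set δ = 1 − n Σ_{i=1}^{s} 1/p_i. Assume δ > 0. If moreover q > (((n−1)/2)((ns − 1)/δ + 2) W(e)^n)^2, then 𝔽_q contains n consecutive primitive elements. -/

import Mathlib

open Finset

/-- An element `g` of a finite field is primitive if it generates the multiplicative
group of nonzero elements, i.e. every nonzero element is a power of `g`. -/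
def IsPrimitiveElem {F : Type*} [Field F] (g : F) : Prop :=
  ∀ x : F, x ≠ 0 → ∃ k : ℕ, g ^ k = x

/-- The field `F` contains `n` consecutive distinct primitive elements: there is `g`
such that `g, g+1, …, g+n-1` are `n` distinct primitive elements. -/
def HasConsecutivePrimitives (F : Type*) [Field F] (n : ℕ) : Prop :=
  ∃ g : F, (∀ k : ℕ, k < n → IsPrimitiveElem (g + (k : F))) ∧
    ∀ i : ℕ, i < n → ∀ j : ℕ, j < n → g + (i : F) = g + (j : F) → i = j

/-- A nonzero element `g` is `e`-free if `g = h ^ d` with `d ∣ e` forces `d = 1`. -/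
def EFree {F : Type*} [Field F] (e : ℕ) (g : F) : Prop :=
  g ≠ 0 ∧ ∀ (h : F) (d : ℕ), d ∣ e → g = h ^ d → d = 1

/-- `Ncount F n e` is the number `N(e₁, …, eₙ)` of `g ∈ F` such that `g + k - 1`
is `eₖ`-free for each `k = 1, …, n`. -/
noncomputable def Ncount (F : Type*) [Field F] (n : ℕ) (e : Fin n → ℕ) : ℕ :=
  Nat.card {g : F // ∀ k : Fin n, EFree (e k) (g + ((k : ℕ) : F))}

/-- `Nn F n e = N(e, …, e)` counts `g ∈ F` with `g, g+1, …, g+n-1` all `e`-free. -/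
noncomputable def Nn (F : Type*) [Field F] (n e : ℕ) : ℕ :=
  Ncount F n (fun _ => e)

/-- `θ(m) = ∏_{ℓ ∣ m, ℓ prime} (1 - 1/ℓ)`. -/
noncomputable def theta (m : ℕ) : ℝ :=
  ∏ l ∈ m.primeFactors, (1 - 1 / (l : ℝ))

/-- `W(m) = 2^{ω(m)}`, the number of squarefree divisors of `m`. -/
def W (m : ℕ) : ℕ := 2 ^ m.primeFactors.card

section LinearIndependence
open Polynomial

/-- If `y ^ d = a` over a field `L` containing a primitive `d`-th root of unity and `a` is not an
`l`-th power for any prime `l ∣ d`, then `y` has degree `d` over `L`. -/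
lemma natDegree_minpoly_of_pow_eq {L Ω : Type*} [Field L] [Field Ω] [IsAlgClosed Ω] [Algebra L Ω]
    {d : ℕ} (hd : 0 < d) {ζ : L} (hζ : IsPrimitiveRoot ζ d) {a : L} (ha0 : a ≠ 0)
    (ha : ∀ l : ℕ, l.Prime → l ∣ d → ∀ b : L, b ^ l ≠ a) {y : Ω}
    (hy : y ^ d = algebraMap L Ω a) : (minpoly L y).natDegree = d := by
  have hy0 : y ≠ 0 := by
    rintro rfl
    rw [zero_pow hd.ne', eq_comm, map_eq_zero] at hy
    exact ha0 hy
  have haev : aeval y (X ^ d - C a) = 0 := by simp [hy]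
  have hint : IsIntegral L y := ⟨X ^ d - C a, monic_X_pow_sub_C a hd.ne', haev⟩
  have hdvd := minpoly.dvd L y haev
  have hle : (minpoly L y).natDegree ≤ d := by
    have := natDegree_le_of_dvd hdvd (X_pow_sub_C_ne_zero hd a)
    rwa [natDegree_X_pow_sub_C] at this
  set s := (minpoly L y).natDegree with hs
  have hspos : 0 < s := minpoly.natDegree_pos hint
  have hζΩ : IsPrimitiveRoot (algebraMap L Ω ζ) d := hζ.map_of_injective (algebraMap L Ω).injective
  have hroot : ∀ r ∈ ((minpoly L y).map (algebraMap L Ω)).roots,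
      ∃ b : L, r = algebraMap L Ω b * y := by
    intro r hr
    have hr1 : aeval r (minpoly L y) = 0 := by
      rw [mem_roots', IsRoot.def, eval_map_algebraMap] at hr
      exact hr.2
    have hr2 : aeval r (X ^ d - C a) = 0 := by
      obtain ⟨k, hk⟩ := hdvd
      rw [hk, map_mul, hr1, zero_mul]
    have hr3 : r ^ d = algebraMap L Ω a := by
      simpa [sub_eq_zero] using hr2
    have : NeZero d := ⟨hd.ne'⟩
    obtain ⟨i, -, hi⟩ := hζΩ.eq_pow_of_pow_eq_one (ξ := r / y) (by
      rw [div_pow, hr3, hy, div_self]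
      rw [Ne, map_eq_zero]
      exact ha0)
    exact ⟨ζ ^ i, by rw [map_pow, hi, div_mul_cancel₀ _ hy0]⟩
  have hprod : ∀ m : Multiset Ω, (∀ r ∈ m, ∃ b : L, r = algebraMap L Ω b * y) →
      ∃ b : L, m.prod = algebraMap L Ω b * y ^ (Multiset.card m) := by
    intro m
    induction m using Multiset.induction_on with
    | empty => exact fun _ ↦ ⟨1, by simp⟩
    | cons r m ih =>
      intro h
      obtain ⟨b, hb⟩ := ih fun r hr ↦ h r (Multiset.mem_cons_of_mem hr)
      obtain ⟨b', hb'⟩ := h r (Multiset.mem_cons_self r m)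
      refine ⟨b' * b, ?_⟩
      rw [Multiset.prod_cons, hb, hb', Multiset.card_cons, map_mul]
      ring
  obtain ⟨b, hb⟩ := hprod _ hroot
  have hsplit : ((minpoly L y).map (algebraMap L Ω)).Splits := IsAlgClosed.splits _
  have hcard : Multiset.card ((minpoly L y).map (algebraMap L Ω)).roots = s := by
    rw [← hsplit.natDegree_eq_card_roots, natDegree_map]
  have hmon : ((minpoly L y).map (algebraMap L Ω)).Monic := (minpoly.monic hint).map _
  have hcoeff := hsplit.coeff_zero_eq_prod_roots_of_monic hmon
  rw [hb, hcard, natDegree_map, coeff_map, ← hs] at hcoeff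
  have hys : ∃ u : L, y ^ s = algebraMap L Ω u := by
    have hne : (minpoly L y).coeff 0 ≠ 0 := minpoly.coeff_zero_ne_zero hint hy0
    have hb0 : algebraMap L Ω b ≠ 0 := by
      intro h0
      rw [h0, zero_mul, mul_zero, map_eq_zero] at hcoeff
      exact hne hcoeff
    refine ⟨(minpoly L y).coeff 0 * ((-1) ^ s * b)⁻¹, ?_⟩
    have h1 : ((-1 : Ω) ^ s) ≠ 0 := pow_ne_zero _ (by simp)
    rw [map_mul, hcoeff, map_inv₀, map_mul, map_pow, map_neg, map_one]
    field_simp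
  obtain ⟨u, hu⟩ := hys
  by_contra hne
  have hlt : s < d := lt_of_le_of_ne hle hne
  set t := Nat.gcd s d with ht
  have htpos : 0 < t := Nat.gcd_pos_of_pos_left _ hspos
  have hyt : ∃ w : L, y ^ t = algebraMap L Ω w := by
    refine ⟨u ^ (Nat.gcdA s d) * a ^ (Nat.gcdB s d), ?_⟩
    rw [map_mul, map_zpow₀, map_zpow₀, ← hu, ← hy, ← zpow_natCast, ← zpow_natCast, ← zpow_natCast,
      ← zpow_mul, ← zpow_mul, ← zpow_add₀ hy0, ← Nat.gcd_eq_gcd_ab]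
  obtain ⟨w, hw⟩ := hyt
  obtain ⟨k, hk⟩ : t ∣ d := Nat.gcd_dvd_right s d
  have hk1 : k ≠ 1 := by
    rintro rfl
    have : t ≤ s := Nat.le_of_dvd hspos (Nat.gcd_dvd_left s d)
    lia
  obtain ⟨l, hl, k', rfl⟩ := Nat.exists_prime_and_dvd hk1
  refine ha l hl ⟨t * k', by rw [hk]; ring⟩ (w ^ k') ?_
  apply (algebraMap L Ω).injective
  rw [← hy, hk, map_pow, map_pow, ← hw, ← pow_mul, ← pow_mul]
  congr 1
  ring

/-- Existence of a `d`-th root of `c / h` whose powers are independent over `E[X]`. -/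
lemma exists_radical_linearIndependent {E : Type*} [Field E] {d : ℕ} (hd : 0 < d) {ζ : E}
    (hζ : IsPrimitiveRoot ζ d) {h : E[X]} (h0 : h ≠ 0) {c : E} (hc : c ≠ 0)
    (hmult : ∀ l : ℕ, l.Prime → l ∣ d → ∃ x, ¬ l ∣ h.rootMultiplicity x) :
    ∃ y : AlgebraicClosure (FractionRing E[X]),
      algebraMap E[X] (AlgebraicClosure (FractionRing E[X])) h * y ^ d = 
        algebraMap E[X] (AlgebraicClosure (FractionRing E[X])) (C c) ∧
      ∀ v : Fin d → E[X],
        ∑ i, algebraMap E[X] (AlgebraicClosure (FractionRing E[X])) (v i) * y ^ (i : ℕ) = 0 →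
          v = 0 := by
  set L := FractionRing E[X]
  set Ω := AlgebraicClosure L
  have hcp : (C c : E[X]) ≠ 0 := C_ne_zero.mpr hc
  have hinj : Function.Injective (algebraMap E[X] L) := IsFractionRing.injective _ _
  have hh : algebraMap E[X] L h ≠ 0 := by simpa using h0
  have hcL : algebraMap E[X] L (C c) ≠ 0 := fun h ↦ hcp (hinj (by rw [h, map_zero]))
  set a : L := algebraMap E[X] L (C c) / algebraMap E[X] L h with ha
  have ha0 : a ≠ 0 := div_ne_zero hcL hh
  obtain ⟨y, hy⟩ := IsAlgClosed.exists_pow_nat_eq (algebraMap L Ω a) hd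
  refine ⟨y, ?_, ?_⟩
  · rw [hy, IsScalarTower.algebraMap_apply E[X] L Ω, IsScalarTower.algebraMap_apply E[X] L Ω,
      ← map_mul, ha, mul_div_cancel₀ _ hh]
  · have hpow : ∀ l : ℕ, l.Prime → l ∣ d → ∀ b : L, b ^ l ≠ a := by
      intro l hl hld b hb
      obtain ⟨x, hx⟩ := hmult l hl hld
      obtain ⟨u, v, hv, rfl⟩ := IsFractionRing.div_surjective (A := E[X]) b
      have hv0 : v ≠ 0 := nonZeroDivisors.ne_zero hv
      have hvL : algebraMap E[X] L v ≠ 0 := fun h ↦ hv0 (hinj (by rw [h, map_zero]))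
      have key : u ^ l * h = C c * v ^ l := by
        apply hinj
        rw [ha, div_pow, div_eq_div_iff (pow_ne_zero _ hvL) hh] at hb
        simpa using hb
      have hu0 : u ≠ 0 := by
        rintro rfl
        rw [zero_pow hl.ne_zero, zero_mul] at key
        exact mul_ne_zero hcp (pow_ne_zero l hv0) key.symm
      classical
      have := congrArg (rootMultiplicity x) key
      rw [rootMultiplicity_mul (mul_ne_zero (pow_ne_zero _ hu0) h0),
        rootMultiplicity_mul (mul_ne_zero hcp (pow_ne_zero _ hv0)), rootMultiplicity_C,
        ← count_roots, ← count_roots, ← count_roots, roots_pow, roots_pow, zero_add,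
        Multiset.count_nsmul, Multiset.count_nsmul, count_roots, count_roots, count_roots] at this
      exact hx ((Nat.dvd_add_right (dvd_mul_right l _)).mp (this ▸ dvd_mul_right l _))
    have hdeg := natDegree_minpoly_of_pow_eq hd
      (hζ.map_of_injective (f := (algebraMap E[X] L).comp C)
        (hinj.comp C_injective)) ha0 hpow hy
    intro v hv
    have hli := linearIndependent_pow (K := L) y
    rw [hdeg, Fintype.linearIndependent_iff] at hli
    funext i
    apply hinj
    rw [Pi.zero_apply, map_zero]
    refine hli (fun i ↦ algebraMap E[X] L (v i)) ?_ i
    rw [← hv]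
    refine Finset.sum_congr rfl fun i _ ↦ ?_
    rw [Algebra.smul_def, IsScalarTower.algebraMap_apply E[X] L Ω]

/-- The matrix of multiplication by `h * ∑ r i * y ^ i` on the powers of `y`, when
`h * y ^ d = c`. -/
def radicalMatrix {R : Type*} [CommRing R] {d : ℕ} [NeZero d] (h c : R) (r : Fin d → R) :
    Matrix (Fin d) (Fin d) R :=
  Matrix.of fun i k ↦ (if i ≤ k then h else c) * r (k - i)

lemma sum_radicalMatrix_mul_pow {R S : Type*} [CommRing R] [CommRing S] [Algebra R S] {d : ℕ}
    [NeZero d] {h c : R} (r : Fin d → R) {y : S}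
    (hy : algebraMap R S h * y ^ d = algebraMap R S c) (i : Fin d) :
    ∑ k, algebraMap R S (radicalMatrix h c r i k) * y ^ (k : ℕ) =
      algebraMap R S h * (∑ k, algebraMap R S (r k) * y ^ (k : ℕ)) * y ^ (i : ℕ) := by
  rw [← Equiv.sum_comp (Equiv.addLeft i), Finset.mul_sum, Finset.sum_mul]
  refine Finset.sum_congr rfl fun k _ ↦ ?_
  simp only [radicalMatrix, Matrix.of_apply, Equiv.coe_addLeft, add_sub_cancel_left]
  have hle : i ≤ i + k ↔ (i : ℕ) ≤ if d ≤ (i : ℕ) + k then (i : ℕ) + k - d else i + k := by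
    rw [Fin.le_def, Fin.val_add_eq_ite]
  simp only [hle, Fin.val_add_eq_ite]
  have hi := i.2
  have hk := k.2
  split_ifs with h1 h2 h2
  · lia
  · rw [map_mul, ← hy]
    have : y ^ d * y ^ ((i : ℕ) + k - d) = y ^ (k : ℕ) * y ^ (i : ℕ) := by
      rw [← pow_add, ← pow_add]
      congr 1
      lia
    linear_combination (algebraMap R S h) * (algebraMap R S (r k)) * this
  · rw [map_mul, pow_add]
    ring
  · lia

lemma natDegree_det_le_of_forall {E : Type*} [Field E] {d B : ℕ} (M : Matrix (Fin d) (Fin d) E[X])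
    (hM : ∀ i k, (M i k).natDegree ≤ B) : M.det.natDegree ≤ d * B := by
  rw [Matrix.det_apply]
  refine natDegree_sum_le_of_forall_le _ _ fun σ _ ↦ ?_
  refine (natDegree_smul_le _ _).trans ((natDegree_prod_le _ _).trans ?_)
  refine (Finset.sum_le_card_nsmul _ _ B fun i _ ↦ hM _ _).trans ?_
  simp

/-- Low degree combinations of the powers of an approximate `d`-th root `g` of `c / h` modulo
`X ^ Q` cannot vanish modulo `X ^ Q` unless they are trivial. -/
lemma eq_zero_of_X_pow_dvd_sum {E Ω : Type*} [Field E] [Field Ω] [Algebra E[X] Ω]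
    {d : ℕ} [NeZero d] {h : E[X]} {c : E} {y : Ω} (hh : algebraMap E[X] Ω h ≠ 0)
    (hy : algebraMap E[X] Ω h * y ^ d = algebraMap E[X] Ω (C c))
    (hli : ∀ v : Fin d → E[X], ∑ i, algebraMap E[X] Ω (v i) * y ^ (i : ℕ) = 0 → v = 0)
    {Q A : ℕ} {g : E[X]} (hg : X ^ Q ∣ h * g ^ d - C c) (hQ : d * (h.natDegree + A) < Q)
    (r : Fin d → E[X]) (hr : ∀ i, (r i).natDegree ≤ A)
    (hdvd : X ^ Q ∣ ∑ i, r i * g ^ (i : ℕ)) : r = 0 := by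
  set M := radicalMatrix h (C c) r with hM
  have hdet : M.det = 0 := by
    have hdeg : M.det.natDegree < Q := by
      refine lt_of_le_of_lt (natDegree_det_le_of_forall M (B := h.natDegree + A) ?_) hQ
      intro i k
      rw [hM, radicalMatrix, Matrix.of_apply]
      refine natDegree_mul_le.trans (add_le_add ?_ (hr _))
      split_ifs
      · exact le_rfl
      · simp
    have hXdet : X ^ Q ∣ M.det := by
      let I := Ideal.span {(X : E[X]) ^ Q}
      let S := E[X] ⧸ I
      have hz : ∀ w : E[X], algebraMap E[X] S w = 0 ↔ X ^ Q ∣ w := fun w ↦ by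
        rw [Ideal.Quotient.algebraMap_eq, Ideal.Quotient.eq_zero_iff_mem,
          Ideal.mem_span_singleton]
      have hgS : algebraMap E[X] S h * (algebraMap E[X] S g) ^ d = algebraMap E[X] S (C c) := by
        rw [← sub_eq_zero, ← map_pow, ← map_mul, ← map_sub, hz]
        exact hg
      have hrS : ∑ k, algebraMap E[X] S (r k) * (algebraMap E[X] S g) ^ (k : ℕ) = 0 := by
        rw [← (hz _).mpr hdvd, map_sum]
        simp
      have hmv : (M.map (algebraMap E[X] S)).mulVec
          (fun k : Fin d ↦ (algebraMap E[X] S g) ^ (k : ℕ)) = 0 := by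
        funext i
        have := sum_radicalMatrix_mul_pow r hgS i
        rw [hrS, mul_zero, zero_mul] at this
        exact this
      have := congrArg (Matrix.mulVec (M.map (algebraMap E[X] S)).adjugate) hmv
      rw [Matrix.mulVec_mulVec, Matrix.adjugate_mul, Matrix.mulVec_zero, Matrix.smul_mulVec,
        Matrix.one_mulVec] at this
      have h0 := congrFun this 0
      simp only [Pi.smul_apply, Fin.val_zero, pow_zero, smul_eq_mul, mul_one,
        Pi.zero_apply] at h0
      rw [← hz, ← h0]
      exact (algebraMap E[X] S).map_det M
    by_contra hne
    have := natDegree_le_of_dvd hXdet hne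
    rw [natDegree_X_pow] at this
    lia
  obtain ⟨v, hv0, hv⟩ := Matrix.exists_vecMul_eq_zero_iff.mpr hdet
  have hsum : ∑ i, algebraMap E[X] Ω (v i) *
      ∑ k, algebraMap E[X] Ω (M i k) * y ^ (k : ℕ) = 0 := by
    simp_rw [Finset.mul_sum]
    rw [Finset.sum_comm]
    refine Finset.sum_eq_zero fun k _ ↦ ?_
    have hk := congrFun hv k
    simp only [Matrix.vecMul, dotProduct, Pi.zero_apply] at hk
    have := congrArg (fun w ↦ algebraMap E[X] Ω w * y ^ (k : ℕ)) hk
    simpa [Finset.sum_mul, mul_assoc] using this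
  simp_rw [hM, sum_radicalMatrix_mul_pow r hy] at hsum
  have hfac : (algebraMap E[X] Ω h * ∑ k, algebraMap E[X] Ω (r k) * y ^ (k : ℕ)) *
      ∑ i, algebraMap E[X] Ω (v i) * y ^ (i : ℕ) = 0 := by
    rw [← hsum, Finset.mul_sum]
    exact Finset.sum_congr rfl fun i _ ↦ by ring
  rcases mul_eq_zero.mp hfac with h1 | h1
  · exact hli r ((mul_eq_zero.mp h1).resolve_left hh)
  · exact absurd (hli v h1) hv0

/-- The auxiliary polynomial of Stepanov's method does not vanish identically. -/
lemma eq_zero_of_sum_mul_X_pow_eq_zero {E Ω : Type*} [Field E] [Field Ω] [Algebra E[X] Ω]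
    {d : ℕ} [NeZero d] {h : E[X]} {c : E} {y : Ω} (hh : algebraMap E[X] Ω h ≠ 0)
    (hy : algebraMap E[X] Ω h * y ^ d = algebraMap E[X] Ω (C c))
    (hli : ∀ v : Fin d → E[X], ∑ i, algebraMap E[X] Ω (v i) * y ^ (i : ℕ) = 0 → v = 0)
    {Q A J : ℕ} {g : E[X]} (hg : X ^ Q ∣ h * g ^ d - C c) (hQ : d * (h.natDegree + A) < Q)
    (r : Fin d → Fin J → E[X]) (hr : ∀ i j, (r i j).natDegree ≤ A)
    (hsum : ∑ j, (∑ i, r i j * g ^ (i : ℕ)) * X ^ (Q * (j : ℕ)) = 0) : r = 0 := by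
  have key : ∀ m : ℕ, ∀ j : Fin J, (j : ℕ) = m → (fun i ↦ r i j) = 0 := by
    intro m
    induction m using Nat.strong_induction_on with
    | _ m ih =>
      intro j hj
      refine eq_zero_of_X_pow_dvd_sum hh hy hli hg hQ (fun i ↦ r i j) (fun i ↦ hr i j) ?_
      rw [← Finset.add_sum_erase _ _ (Finset.mem_univ j)] at hsum
      have hrest : X ^ (Q * (j : ℕ) + Q) ∣ ∑ k ∈ Finset.univ.erase j,
          (∑ i, r i k * g ^ (i : ℕ)) * X ^ (Q * (k : ℕ)) := by
        refine Finset.dvd_sum fun k hk ↦ ?_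
        rcases lt_or_gt_of_ne (Fin.val_ne_of_ne (Finset.ne_of_mem_erase hk)) with hlt | hgt
        · have := ih k (by lia) k rfl
          have hz : ∑ i, r i k * g ^ (i : ℕ) = 0 :=
            Finset.sum_eq_zero fun i _ ↦ by rw [congrFun this i, Pi.zero_apply, zero_mul]
          rw [hz, zero_mul]
          exact dvd_zero _
        · refine Dvd.dvd.mul_left (pow_dvd_pow _ ?_) _
          calc Q * (j : ℕ) + Q = Q * (j + 1) := by ring
            _ ≤ Q * k := Nat.mul_le_mul_left _ hgt
      have h1 : X ^ (Q * (j : ℕ) + Q) ∣ (∑ i, r i j * g ^ (i : ℕ)) * X ^ (Q * (j : ℕ)) := by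
        rw [eq_neg_of_add_eq_zero_left hsum]
        exact hrest.neg_right
      rw [pow_add, mul_comm] at h1
      exact (mul_dvd_mul_iff_right (pow_ne_zero _ X_ne_zero)).mp h1
  funext i j
  exact congrFun (key j j rfl) i

end LinearIndependence

section Stepanov

open Polynomial

lemma pow_sub_dvd_hasseDeriv_mul_pow {E : Type*} [Field E] (r h : E[X]) (e l : ℕ) :
    h ^ (e - l) ∣ hasseDeriv l (r * h ^ e) := by
  induction e generalizing l with
  | zero => simp
  | succ e ih =>
    rw [pow_succ, ← mul_assoc, hasseDeriv_mul]
    refine Finset.dvd_sum fun uv huv ↦ ?_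
    have huv' := HasAntidiagonal.mem_antidiagonal.mp huv
    rcases Nat.eq_zero_or_pos uv.2 with h0 | h0
    · rw [h0, hasseDeriv_zero']
      refine dvd_trans ?_ (mul_dvd_mul_right (ih uv.1) h)
      rw [← pow_succ]
      exact pow_dvd_pow _ (by lia)
    · exact dvd_mul_of_dvd_left ((pow_dvd_pow _ (by lia)).trans (ih uv.1)) _

/-- Hasse derivatives of `r * h ^ e` are `h ^ (e - l)` times a polynomial depending linearly
on `r`, whose degree is controlled. -/
lemma exists_linearMap_hasseDeriv_mul_pow {E : Type*} [Field E] {h : E[X]} (hm : h.Monic)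
    (e l : ℕ) (hl : l ≤ e) : ∃ S : E[X] →ₗ[E] E[X], ∀ r,
      hasseDeriv l (r * h ^ e) = h ^ (e - l) * S r ∧
        (S r).natDegree ≤ r.natDegree + l * h.natDegree := by
  have hmon : (h ^ (e - l)).Monic := hm.pow _
  have hS (r : E[X]) : hasseDeriv l (r * h ^ e) =
      h ^ (e - l) * (hasseDeriv l (r * h ^ e) /ₘ h ^ (e - l)) := by
    obtain ⟨s, hs⟩ := pow_sub_dvd_hasseDeriv_mul_pow r h e l
    rw [hs, mul_divByMonic_cancel_left _ hmon]
  refine ⟨{ toFun := fun r ↦ hasseDeriv l (r * h ^ e) /ₘ h ^ (e - l)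
            map_add' := fun a b ↦ ?_
            map_smul' := fun a b ↦ ?_ }, fun r ↦ ⟨hS r, ?_⟩⟩
  · apply mul_left_cancel₀ hmon.ne_zero
    rw [mul_add, ← hS, ← hS, ← hS, add_mul, map_add]
  · apply mul_left_cancel₀ hmon.ne_zero
    rw [RingHom.id_apply, mul_smul_comm, ← hS, ← hS, smul_mul_assoc, map_smul]
  · simp only [LinearMap.coe_mk, AddHom.coe_mk]
    rw [natDegree_divByMonic _ hmon, natDegree_pow]
    have h1 := natDegree_hasseDeriv_le (r * h ^ e) l
    have h2 : (r * h ^ e).natDegree ≤ r.natDegree + e * h.natDegree := by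
      simpa [natDegree_pow] using natDegree_mul_le (p := r) (q := h ^ e)
    have h3 : e * h.natDegree = (e - l) * h.natDegree + l * h.natDegree := by
      rw [← add_mul, Nat.sub_add_cancel hl]
    lia

lemma X_sub_C_pow_dvd_of_eval_hasseDeriv {E : Type*} [Field E] {p : E[X]} {x : E} {M : ℕ}
    (hp : ∀ l < M, (hasseDeriv l p).eval x = 0) : (X - C x) ^ M ∣ p := by
  rw [X_sub_C_pow_dvd_iff, X_pow_dvd_iff]
  intro l hl
  rw [← taylor_apply, taylor_coeff, hp l hl]

lemma exists_nonzero_of_mul_lt {E : Type*} [Field E] {d J A M B : ℕ}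
    (hlt : M * B < d * J * (A + 1)) (S : Fin M → Fin d → Fin J → E[X] →ₗ[E] E[X])
    (hS : ∀ l i j r, r.natDegree ≤ A → (S l i j r).natDegree < B) :
    ∃ r : Fin d → Fin J → E[X], r ≠ 0 ∧ (∀ i j, (r i j).natDegree ≤ A) ∧
      ∀ l, ∑ i, ∑ j, S l i j (r i j) = 0 := by
  let V := Fin d → Fin J → degreeLT E (A + 1)
  let T : V →ₗ[E] (Fin M → Fin B → E) := LinearMap.pi fun l ↦ LinearMap.pi fun b ↦
    lcoeff E b ∘ₗ ∑ i, ∑ j, S l i j ∘ₗ (degreeLT E (A + 1)).subtype ∘ₗ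
      LinearMap.proj j ∘ₗ LinearMap.proj i
  have : Module.Finite E (degreeLT E (A + 1)) :=
    Module.Finite.equiv (degreeLTEquiv E (A + 1)).symm
  have hfr : Module.finrank E (degreeLT E (A + 1)) = A + 1 := by
    rw [(degreeLTEquiv E (A + 1)).finrank_eq, Module.finrank_fin_fun]
  have hker : LinearMap.ker T ≠ ⊥ := by
    apply LinearMap.ker_ne_bot_of_finrank_lt
    simp only [V, Module.finrank_pi_fintype, hfr, Finset.sum_const, Finset.card_univ,
      Fintype.card_fin, smul_eq_mul, Module.finrank_self, mul_one]
    rwa [← mul_assoc]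
  obtain ⟨r, hr, hr0⟩ := (Submodule.ne_bot_iff _).mp hker
  have hdeg (i : Fin d) (j : Fin J) : (r i j : E[X]).natDegree ≤ A :=
    by
    have h1 := mem_degreeLT.mp (r i j).2
    by_cases h0 : (r i j : E[X]) = 0
    · simp [h0]
    · exact Nat.lt_succ_iff.mp ((natDegree_lt_iff_degree_lt h0).mpr (by exact_mod_cast h1))
  refine ⟨fun i j ↦ r i j, fun h0 ↦ hr0 ?_, hdeg, fun l ↦ ?_⟩
  · funext i j
    exact Subtype.ext (congrFun (congrFun h0 i) j)
  · ext b
    rw [coeff_zero]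
    by_cases hb : b < B
    · have := congrFun (congrFun (LinearMap.mem_ker.mp hr) l) ⟨b, hb⟩
      simp only [T, LinearMap.pi_apply, LinearMap.comp_apply, LinearMap.sum_apply,
        LinearMap.proj_apply, Submodule.subtype_apply, lcoeff_apply, Pi.zero_apply] at this
      exact this
    · rw [finsetSum_coeff]
      refine Finset.sum_eq_zero fun i _ ↦ ?_
      rw [finsetSum_coeff]
      refine Finset.sum_eq_zero fun j _ ↦ ?_
      exact coeff_eq_zero_of_natDegree_lt ((hS l i j _ (hdeg i j)).trans_le (not_lt.mp hb))

lemma sub_C_pow_card {E : Type*} [Field E] [Fintype E] (f : E[X]) (c : E) :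
    (f - C c) ^ Fintype.card E = f ^ Fintype.card E - C c := by
  obtain ⟨p, hp, n, hpp, hcard⟩ := FiniteField.card' E
  have : Fact p.Prime := ⟨hpp⟩
  have h1 : (C c : E[X]) = C c ^ Fintype.card E := by rw [← C_pow, FiniteField.pow_card]
  conv_rhs => rw [h1]
  rw [hcard, sub_pow_char_pow]

lemma mul_card_le_natDegree_of_dvd {E : Type*} [Field E] {R : E[X]} (hR : R ≠ 0) {M : ℕ}
    (s : Finset E) (hs : ∀ x ∈ s, (X - C x) ^ M ∣ R) : M * #s ≤ R.natDegree := by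
  have h1 : ∏ x ∈ s, (X - C x) ^ M ∣ R := by
    refine Finset.prod_dvd_of_coprime (fun x _ y _ hxy ↦ ?_) hs
    exact (pairwise_coprime_X_sub_C (s := id) Function.injective_id hxy).pow
  have h2 := natDegree_le_of_dvd h1 hR
  rw [natDegree_prod_of_monic _ _ fun x _ ↦ (monic_X_sub_C x).pow M] at h2
  simpa [mul_comm] using h2

/-- Stepanov's method: a bound for the number of points on a superelliptic curve, with free
parameters. -/
theorem mul_card_pow_eq_le {E : Type*} [Field E] [Fintype E] [DecidableEq E] {d N : ℕ}
    (hd : 0 < d) (hcard : Fintype.card E = d * N + 1) {ζ : E} (hζ : IsPrimitiveRoot ζ d)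
    {h : E[X]} (hm : h.Monic) (hc : h.eval 0 ≠ 0)
    (hmult : ∀ l, l.Prime → l ∣ d → ∃ x, ¬ l ∣ h.rootMultiplicity x) {M A J : ℕ}
    (hsys : M * (A + M * h.natDegree + J) < d * J * (A + 1))
    (hA : d * (h.natDegree + A) < Fintype.card E) (hM : M ≤ Fintype.card E) (z : E) :
    M * #{x | (h.eval x) ^ N = z} ≤
      A + h.natDegree * (d * N + M) + Fintype.card E * J := by
  have : NeZero d := ⟨hd.ne'⟩
  set Q := Fintype.card E with hQdef
  choose S hS using fun (l : Fin M) (i : Fin d) ↦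
    exists_linearMap_hasseDeriv_mul_pow hm (i * N + M) l (l.2.le.trans (Nat.le_add_left _ _))
  obtain ⟨r, hr0, hrA, hrT⟩ := exists_nonzero_of_mul_lt hsys
    (fun l i j ↦ LinearMap.mulLeft E (C (z ^ (i : ℕ)) * X ^ (j : ℕ)) ∘ₗ S l i) (by
      intro l i j r hr
      have h1 := (hS l i r).2
      have h2 : (C (z ^ (i : ℕ)) * X ^ (j : ℕ) : E[X]).natDegree ≤ j :=
        natDegree_C_mul_X_pow_le _ _
      have h3 : (C (z ^ (i : ℕ)) * X ^ (j : ℕ) * S l i r).natDegree ≤ _ :=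
        natDegree_mul_le
      have h4 : (l : ℕ) * h.natDegree ≤ M * h.natDegree := Nat.mul_le_mul_right _ l.2.le
      have := j.2
      simp only [LinearMap.comp_apply, LinearMap.mulLeft_apply]
      lia)
  set R : E[X] := ∑ j, (∑ i, r i j * h ^ (i * N + M)) * X ^ (Q * (j : ℕ)) with hR
  have hRne : R ≠ 0 := by
    intro h0
    apply hr0
    obtain ⟨y, hy, hli⟩ := exists_radical_linearIndependent hd hζ hm.ne_zero hc hmult
    have hinj : Function.Injective (algebraMap E[X] (AlgebraicClosure (FractionRing E[X]))) := by
      rw [IsScalarTower.algebraMap_eq E[X] (FractionRing E[X])]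
      exact (algebraMap (FractionRing E[X]) _).injective.comp (IsFractionRing.injective _ _)
    refine eq_zero_of_sum_mul_X_pow_eq_zero (g := h ^ N)
      ((map_ne_zero_iff _ hinj).mpr hm.ne_zero) hy hli ?_ hA r hrA ?_
    · have h1 : h * (h ^ N) ^ d = h ^ Q := by
        rw [hcard]
        ring
      rw [h1, hQdef, ← sub_C_pow_card]
      refine pow_dvd_pow_of_dvd ?_ _
      rw [X_dvd_iff]
      simp [coeff_zero_eq_eval_zero]
    · apply mul_left_cancel₀ (pow_ne_zero M hm.ne_zero)
      rw [mul_zero, ← h0, hR, Finset.mul_sum]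
      refine Finset.sum_congr rfl fun j _ ↦ ?_
      rw [← mul_assoc, Finset.mul_sum]
      congr 1
      exact Finset.sum_congr rfl fun i _ ↦ by ring
  have hRdeg : R.natDegree ≤ A + h.natDegree * (d * N + M) + Q * J := by
    refine natDegree_sum_le_of_forall_le _ _ fun j _ ↦ ?_
    refine natDegree_mul_le.trans (add_le_add ?_ ?_)
    · refine natDegree_sum_le_of_forall_le _ _ fun i _ ↦ ?_
      refine natDegree_mul_le.trans (add_le_add (hrA i j) ?_)
      rw [natDegree_pow, mul_comm]
      exact Nat.mul_le_mul_left _ (Nat.add_le_add_right (Nat.mul_le_mul_right _ i.2.le) _)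
    · rw [natDegree_X_pow]
      exact Nat.mul_le_mul_left _ j.2.le
  refine (mul_card_le_natDegree_of_dvd hRne _ fun x hx ↦ ?_).trans hRdeg
  rw [Finset.mem_filter] at hx
  set R' : E[X] := ∑ j : Fin J, ∑ i : Fin d, x ^ (j : ℕ) • (r i j * h ^ (i * N + M)) with hR'
  have hsub : (X - C x) ^ M ∣ R - R' := by
    refine (pow_dvd_pow _ hM).trans ?_
    rw [sub_C_pow_card, hR, hR', ← Finset.sum_sub_distrib]
    refine Finset.dvd_sum fun j _ ↦ ?_
    rw [← Finset.smul_sum, smul_eq_C_mul, mul_comm (C _), ← mul_sub]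
    refine Dvd.dvd.mul_left ?_ _
    rw [pow_mul, C_pow]
    exact sub_dvd_pow_sub_pow _ _ _
  rw [← sub_add_cancel R R']
  refine dvd_add hsub (X_sub_C_pow_dvd_of_eval_hasseDeriv fun l hl ↦ ?_)
  have hT := congrArg (eval x) (hrT ⟨l, hl⟩)
  simp only [LinearMap.comp_apply, LinearMap.mulLeft_apply, eval_finsetSum, eval_mul, eval_C,
    eval_pow, eval_X, eval_zero] at hT
  rw [Finset.sum_comm] at hT
  have hT' := congrArg ((eval x h) ^ (M - l) * ·) hT
  simp only [mul_zero] at hT'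
  rw [← hT', hR', map_sum, eval_finsetSum, Finset.mul_sum]
  refine Finset.sum_congr rfl fun j _ ↦ ?_
  rw [map_sum, eval_finsetSum, Finset.mul_sum]
  refine Finset.sum_congr rfl fun i _ ↦ ?_
  rw [map_smul, (hS ⟨l, hl⟩ i _).1, eval_smul, eval_mul, eval_pow, Nat.add_sub_assoc hl.le,
    pow_add, mul_comm (i : ℕ) N, pow_mul, hx.2, smul_eq_mul]
  ring

/-- Optimisation of the free parameters in Stepanov's method. -/
lemma le_add_mul_sqrt_of_forall {d N Q m n M : ℕ} (hd : 0 < d) (hcard : Q = d * N + 1)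
    (hnQ : n ≤ Q) (hM1 : M * M ≤ Q) (hM2 : Q < (M + 1) * (M + 1))
    (key : ∀ A J, M * (A + M * m + J) < d * J * (A + 1) → d * (m + A) < Q → M ≤ Q →
      M * n ≤ A + m * (d * N + M) + Q * J) :
    (d : ℝ) * n ≤ Q + d * (8 * m + 2 * d * m + 12) * √Q := by
  have hs0 : 0 ≤ √(Q : ℝ) := Real.sqrt_nonneg _
  have hss : √(Q : ℝ) * √Q = Q := Real.mul_self_sqrt (Nat.cast_nonneg _)
  have hsM : √(Q : ℝ) ≤ M + 1 := by
    rw [Real.sqrt_le_left (by positivity), sq]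
    exact_mod_cast hM2.le
  have hd0 : (0 : ℝ) < d := Nat.cast_pos.mpr hd
  rcases lt_or_ge M (2 * m + 5 + 2 * d * m) with hsmall | hlarge
  · have h1 : (M : ℝ) + 1 ≤ 2 * m + 5 + 2 * d * m := by exact_mod_cast hsmall
    have h2 : (Q : ℝ) ≤ (2 * m + 5 + 2 * d * m) * √Q := by
      nlinarith
    have h3 : (d : ℝ) * n ≤ d * Q := by gcongr
    have h4 : (d : ℝ) * Q ≤ d * ((2 * m + 5 + 2 * d * m) * √Q) := by gcongr
    have h5 : (d : ℝ) * ((2 * m + 5 + 2 * d * m) * √Q) ≤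
        d * (8 * m + 2 * d * m + 12) * √Q := by
      rw [← mul_assoc]
      refine mul_le_mul_of_nonneg_right (mul_le_mul_of_nonneg_left ?_ hd0.le) hs0
      linarith [(Nat.cast_nonneg m : (0 : ℝ) ≤ m)]
    linarith [(Nat.cast_nonneg Q : (0 : ℝ) ≤ Q)]
  · have hMQ : M ≤ Q := (Nat.le_mul_self M).trans hM1
    have hA1 : 2 * d * (Q / (2 * d)) ≤ Q := Nat.mul_div_le _ _
    have hA2 : Q < 2 * d * (Q / (2 * d) + 1) := Nat.lt_mul_div_succ _ (by lia)
    have hJ1 : d * (M / d) ≤ M := Nat.mul_div_le _ _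
    have hJ2 : M < d * (M / d + 1) := Nat.lt_mul_div_succ _ hd
    set A := Q / (2 * d)
    set k := M / d
    have hkM : k ≤ M := Nat.div_le_self _ _
    have hsys : M * (A + M * m + (k + 2 * m + 5)) < d * (k + 2 * m + 5) * (A + 1) := by
      have e1 : (M + 1) * (A + 1) ≤ d * (k + 1) * (A + 1) := Nat.mul_le_mul_right _ hJ2
      have e2 : (Q + 1) * (m + 2) ≤ (2 * d * (A + 1)) * (m + 2) := Nat.mul_le_mul_right _ hA2
      have e3 : M * k ≤ M * M := Nat.mul_le_mul_left _ hkM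
      have e4 : M * (2 * m + 5) ≤ M * M := Nat.mul_le_mul_left _ (by lia)
      have e5 : M * M * m ≤ Q * m := Nat.mul_le_mul_right _ hM1
      nlinarith
    have hdA : d * (m + A) < Q := by nlinarith
    have h1 := key A (k + 2 * m + 5) hsys hdA hMQ
    have hMpos : (0 : ℝ) < M := by exact_mod_cast (show 0 < M by lia)
    have h2 : M * (d * n) ≤ Q * M + Q * (d * (4 * m + 6)) := by
      have e1 : d * (M * n) ≤ d * _ := Nat.mul_le_mul_left d h1
      have e2 : d * m * (d * N + M) ≤ d * m * (Q + Q) := Nat.mul_le_mul_left _ (by lia)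
      have e3 : Q * (d * k) ≤ Q * M := Nat.mul_le_mul_left _ hJ1
      have e4 : Q ≤ d * Q := Nat.le_mul_of_pos_left _ hd
      nlinarith
    have h2' : (M : ℝ) * (d * n) ≤ Q * M + Q * (d * (4 * m + 6)) := by exact_mod_cast h2
    have h3 : (Q : ℝ) ≤ 2 * √Q * M := by
      have : (1 : ℝ) ≤ M := by exact_mod_cast (show 1 ≤ M by lia)
      nlinarith
    have h4 : (M : ℝ) * (d * n) ≤ M * (Q + 2 * √Q * (d * (4 * m + 6))) := by
      have : Q * (d * (4 * m + 6)) ≤ 2 * √Q * M * ((d : ℝ) * (4 * m + 6)) := by gcongr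
      linarith
    have h5 := le_of_mul_le_mul_left h4 hMpos
    have h6 : 2 * √Q * (d * (4 * m + 6)) ≤ d * (8 * m + 2 * d * m + 12) * √Q := by
      have : 0 ≤ (d : ℝ) * (2 * d * m) * √Q := by positivity
      linarith
    linarith

/-- Stepanov's bound for the number of points on a superelliptic curve. -/
theorem card_pow_eq_le {E : Type*} [Field E] [Fintype E] [DecidableEq E] {d N : ℕ}
    (hd : 0 < d) (hcard : Fintype.card E = d * N + 1) {ζ : E} (hζ : IsPrimitiveRoot ζ d)
    {h : E[X]} (hm : h.Monic) (hc : h.eval 0 ≠ 0)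
    (hmult : ∀ l, l.Prime → l ∣ d → ∃ x, ¬ l ∣ h.rootMultiplicity x) (z : E) :
    (d : ℝ) * #{x | (h.eval x) ^ N = z} ≤ Fintype.card E +
      d * (8 * h.natDegree + 2 * d * h.natDegree + 12) * √(Fintype.card E) := by
  exact le_add_mul_sqrt_of_forall hd hcard (Finset.card_le_univ _) (Nat.sqrt_le _)
    (Nat.lt_succ_sqrt _) fun A J h1 h2 h3 ↦
      mul_card_pow_eq_le hd hcard hζ hm hc hmult h1 h2 h3 z

end Stepanov

section ExtensionSums

open Polynomial

lemma MulChar.norm_apply_le_one {M : Type*} [CommMonoid M] [Finite Mˣ] (χ : MulChar M ℂ) (x : M) :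
    ‖χ x‖ ≤ 1 := by
  cases nonempty_fintype Mˣ
  by_cases hx : IsUnit x
  · obtain ⟨u, rfl⟩ := hx
    refine le_of_eq (Complex.norm_eq_one_of_pow_eq_one (n := Fintype.card Mˣ) ?_
      Fintype.card_ne_zero)
    rw [← MulChar.pow_apply_coe, MulChar.pow_card_eq_one, MulChar.one_apply_coe]
  · simp [χ.map_nonunit hx]

lemma MulChar.isCyclic_complex (K : Type*) [Field K] [Finite K] : IsCyclic (MulChar K ℂ) := by
  obtain ⟨e⟩ := MulChar.mulEquiv_units K ℂ
  exact isCyclic_of_surjective e.symm e.symm.surjective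

lemma exists_pow_eq_of_pow_eq_one {G : Type*} [Group G] [Finite G] [IsCyclic G] {d n : ℕ}
    (hn : 0 < n) (hG : Nat.card G = d * n) {u : G} (hu : u ^ n = 1) : ∃ w, u = w ^ d := by
  obtain ⟨g, hg⟩ := IsCyclic.exists_generator (α := G)
  obtain ⟨i, rfl⟩ := mem_powers_iff_mem_zpowers.mpr (hg u)
  simp only at hu
  rw [← pow_mul, ← orderOf_dvd_iff_pow_eq_one, orderOf_eq_card_of_forall_mem_zpowers hg, hG] at hu
  obtain ⟨k, rfl⟩ := Nat.dvd_of_mul_dvd_mul_right hn hu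
  exact ⟨g ^ k, by rw [← pow_mul, mul_comm]⟩

lemma card_pow_eq_pow {G : Type*} [CommGroup G] [Fintype G] [DecidableEq G] [IsCyclic G] {n : ℕ}
    (hG : n ∣ Nat.card G) (v : G) : #{u : G | u ^ n = v ^ n} = n := by
  have h1 := IsCyclic.card_powMonoidHom_ker (G := G) n
  rw [Nat.gcd_eq_right hG] at h1
  refine Eq.trans ?_ h1
  rw [← Nat.card_eq_fintype_card.trans (Fintype.card_coe _)]
  refine Nat.card_congr ((Equiv.mulRight v⁻¹).subtypeEquiv fun u ↦ ?_)
  simp [MonoidHom.mem_ker, mul_pow, mul_inv_eq_one]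

lemma MulChar.apply_eq_of_pow_eq {K : Type*} [Field K] [Finite K] {ψ : MulChar K ℂ} {d n : ℕ}
    (hψ : ψ ^ d = 1) (hn : 0 < n) (hK : Nat.card Kˣ = d * n) {u v : Kˣ} (huv : u ^ n = v ^ n) :
    ψ u = ψ v := by
  obtain ⟨w, hw⟩ := exists_pow_eq_of_pow_eq_one (u := u * v⁻¹) hn hK
    (by rw [mul_pow, inv_pow, huv, mul_inv_cancel])
  rw [mul_inv_eq_iff_eq_mul] at hw
  rw [hw, Units.val_mul, Units.val_pow_eq_pow_val, map_mul, map_pow, ← MulChar.pow_apply_coe, hψ,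
    MulChar.one_apply_coe, one_mul]

/-- Square root cancellation, up to a constant, for the sums of a multiplicative character of a
finite field at the norms of the values of a polynomial over an extension. -/
theorem norm_sum_mulChar_norm_eval_le {K E : Type*} [Field K] [Finite K] [Field E] [Fintype E]
    [Algebra K E] {ψ : MulChar K ℂ} (hψ : ψ ≠ 1)
    {h : E[X]} (hm : h.Monic) (hc : h.eval 0 ≠ 0)
    (hmult : ∀ l, l.Prime → l ∣ orderOf ψ → ∃ x, ¬ l ∣ h.rootMultiplicity x) :
    ‖∑ x : E, ψ (Algebra.norm K (h.eval x))‖ ≤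
      (orderOf ψ * (8 * h.natDegree + 2 * orderOf ψ * h.natDegree + 12) + h.natDegree) *
        √(Fintype.card E) := by
  classical
  cases nonempty_fintype K
  set d := orderOf ψ with hd
  have hd0 : 0 < d := MulChar.orderOf_pos ψ
  obtain ⟨n, hn⟩ : d ∣ Fintype.card K - 1 := MulChar.orderOf_dvd_card_sub_one K ψ
  obtain ⟨a, ha⟩ : Nat.card K - 1 ∣ Nat.card E - 1 := by
    rw [Module.natCard_eq_pow_finrank (K := K) (V := E)]
    exact Nat.sub_one_dvd_pow_sub_one _ _
  have hK1 : 0 < Fintype.card K - 1 := Nat.sub_pos_of_lt Fintype.one_lt_card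
  have hE1 : 0 < Fintype.card E - 1 := Nat.sub_pos_of_lt Fintype.one_lt_card
  have hn0 : 0 < n := Nat.pos_of_mul_pos_left (hn ▸ hK1)
  rw [Nat.card_eq_fintype_card, Nat.card_eq_fintype_card] at ha
  have hKu : Nat.card Kˣ = d * n := by
    rw [Nat.card_eq_fintype_card, Fintype.card_units, hn]
  have ha0 : 0 < a := Nat.pos_of_mul_pos_left (ha ▸ hE1)
  have hcard : Fintype.card E = d * (n * a) + 1 := by
    rw [← mul_assoc, ← hn, ← ha]
    lia
  have hnorm (y : E) : y ^ (n * a) = algebraMap K E (Algebra.norm K y ^ n) := by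
    rw [map_pow, FiniteField.algebraMap_norm_eq_pow, Nat.card_eq_fintype_card,
      Nat.card_eq_fintype_card, ha, Nat.mul_div_cancel_left _ hK1, ← pow_mul, mul_comm]
  obtain ⟨ζ, hζ⟩ : ∃ ζ : E, IsPrimitiveRoot ζ d := by
    obtain ⟨g, hg⟩ := IsCyclic.exists_generator (α := Eˣ)
    have h1 : IsPrimitiveRoot g (d * (n * a)) := by
      rw [IsPrimitiveRoot.iff_orderOf, orderOf_eq_card_of_forall_mem_zpowers hg,
        Nat.card_eq_fintype_card, Fintype.card_units, hcard, Nat.add_sub_cancel]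
    have h2 := h1.pow (by positivity) (mul_comm d (n * a))
    exact ⟨_, IsPrimitiveRoot.coe_units_iff.mpr h2⟩
  set C : ℝ := d * (8 * h.natDegree + 2 * d * h.natDegree + 12) with hC
  set s := √(Fintype.card E : ℝ) with hs
  let T (u : Kˣ) : Finset E := {x | (h.eval x) ^ (n * a) = algebraMap K E ((u : K) ^ n)}
  have hT (u : Kˣ) : (d : ℝ) * #(T u) ≤ Fintype.card E + C * s :=
    card_pow_eq_le hd0 hcard hζ hm hc hmult _
  have hmem (u : Kˣ) (x : E) : x ∈ T u ↔ Algebra.norm K (h.eval x) ^ n = (u : K) ^ n := by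
    simp only [T, Finset.mem_filter, Finset.mem_univ, true_and, hnorm]
    exact (algebraMap K E).injective.eq_iff
  have hzero {x : E} (hx : h.eval x = 0) (u : Kˣ) : x ∉ T u := by
    rw [hmem, hx, Algebra.norm_zero, zero_pow hn0.ne']
    exact (pow_ne_zero n u.ne_zero).symm
  have hfib {x : E} (hx : h.eval x ≠ 0) : ∃ v : Kˣ, (v : K) = Algebra.norm K (h.eval x) ∧
      ∀ u, x ∈ T u ↔ u ^ n = v ^ n := by
    refine ⟨Units.mk0 _ (Algebra.norm_ne_zero_iff.mpr hx), rfl, fun u ↦ ?_⟩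
    rw [hmem, eq_comm, Units.ext_iff]
    simp
  have hsum1 (x : E) : ∑ u : Kˣ, (if x ∈ T u then ψ u else 0) =
      n * ψ (Algebra.norm K (h.eval x)) := by
    by_cases hx : h.eval x = 0
    · simp [hzero hx, hx, Algebra.norm_zero, MulChar.map_zero ψ]
    · obtain ⟨v, hv, hv'⟩ := hfib hx
      rw [← Finset.sum_filter, Finset.sum_congr (g := fun _ ↦ ψ v) rfl, Finset.sum_const, ← hv]
      · simp_rw [hv', nsmul_eq_mul]
        rw [card_pow_eq_pow (hKu ▸ dvd_mul_left n d)]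
      · intro u hu
        rw [Finset.mem_filter, hv'] at hu
        exact MulChar.apply_eq_of_pow_eq (pow_orderOf_eq_one ψ) hn0 hKu hu.2
  have hsum2 : n * (Fintype.card E - h.natDegree : ℝ) ≤ ∑ u : Kˣ, (#(T u) : ℝ) := by
    have h1 : Fintype.card E - h.natDegree ≤ #{x : E | h.eval x ≠ 0} := by
      have h2 : #{x : E | h.eval x = 0} ≤ h.natDegree := by
        refine le_trans (Finset.card_le_card fun x hx ↦ ?_)
          ((Multiset.toFinset_card_le h.roots).trans (card_roots' h))
        rw [Multiset.mem_toFinset, mem_roots hm.ne_zero]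
        exact (Finset.mem_filter.mp hx).2
      have h3 := Finset.card_filter_add_card_filter_not (s := (univ : Finset E))
        (fun x ↦ h.eval x = 0)
      rw [Finset.card_univ] at h3
      simp only [ne_eq]
      lia
    have h2 : ∑ u : Kˣ, #(T u) = ∑ x : E, #{u : Kˣ | x ∈ T u} := by
      simp_rw [Finset.card_eq_sum_ones, Finset.sum_filter]
      rw [Finset.sum_comm]
      refine Finset.sum_congr rfl fun u _ ↦ ?_
      rw [← Finset.sum_filter]
      simp
    have h3 : n * #{x : E | h.eval x ≠ 0} ≤ ∑ x : E, #{u : Kˣ | x ∈ T u} := by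
      rw [mul_comm, ← smul_eq_mul, ← Finset.sum_const, Finset.sum_filter]
      refine Finset.sum_le_sum fun x _ ↦ ?_
      split_ifs with hx
      · obtain ⟨v, -, hv'⟩ := hfib hx
        simp_rw [hv']
        rw [card_pow_eq_pow (hKu ▸ dvd_mul_left n d)]
      · exact Nat.zero_le _
    have h4 : (n : ℝ) * #{x : E | h.eval x ≠ 0} ≤ ∑ u : Kˣ, (#(T u) : ℝ) := by
      exact_mod_cast h2 ▸ h3
    refine le_trans (mul_le_mul_of_nonneg_left ?_ (Nat.cast_nonneg n)) h4
    rw [sub_le_iff_le_add]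
    exact_mod_cast Nat.sub_le_iff_le_add.mp h1
  set U : ℝ := (Fintype.card E + C * s) / d with hU
  have hdR : (0 : ℝ) < d := Nat.cast_pos.mpr hd0
  have hnR : (0 : ℝ) < n := Nat.cast_pos.mpr hn0
  have hTU (u : Kˣ) : (#(T u) : ℝ) ≤ U := by
    rw [hU, le_div_iff₀' hdR]
    exact hT u
  have hψ0 : ∑ u : Kˣ, ψ u = 0 := by
    refine sum_hom_units_eq_zero (ψ.toMonoidHom.comp (Units.coeHom K)) fun h1 ↦ hψ ?_
    rw [MulChar.eq_one_iff]
    exact fun u ↦ DFunLike.congr_fun h1 u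
  have hmain : n * ∑ x : E, ψ (Algebra.norm K (h.eval x)) =
      ∑ u : Kˣ, ψ u * (((#(T u) : ℝ) - U : ℝ) : ℂ) := by
    simp_rw [Complex.ofReal_sub, mul_sub]
    rw [Finset.sum_sub_distrib, ← Finset.sum_mul, hψ0, zero_mul, sub_zero, Finset.mul_sum]
    simp_rw [← hsum1]
    rw [Finset.sum_comm]
    refine Finset.sum_congr rfl fun u _ ↦ ?_
    rw [← Finset.sum_filter]
    simp [mul_comm]
  have hnorm_le : n * ‖∑ x : E, ψ (Algebra.norm K (h.eval x))‖ ≤ ∑ u : Kˣ, (U - #(T u)) := by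
    have h1 := congrArg norm hmain
    rw [norm_mul, Complex.norm_natCast] at h1
    rw [h1]
    refine (norm_sum_le _ _).trans (Finset.sum_le_sum fun u _ ↦ ?_)
    rw [norm_mul, Complex.norm_real, Real.norm_eq_abs, abs_of_nonpos (by linarith [hTU u])]
    exact (mul_le_of_le_one_left (by linarith [hTU u]) (ψ.norm_apply_le_one _)).trans
      (by linarith)
  have hU2 : ∑ u : Kˣ, U = n * (Fintype.card E + C * s) := by
    rw [Finset.sum_const, Finset.card_univ, ← Nat.card_eq_fintype_card, hKu, nsmul_eq_mul, hU]
    push_cast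
    field_simp
  rw [Finset.sum_sub_distrib, hU2] at hnorm_le
  have hs1 : 1 ≤ s := Real.one_le_sqrt.mpr (by exact_mod_cast Fintype.card_pos)
  refine le_of_mul_le_mul_left (hnorm_le.trans ?_) hnR
  have : (h.natDegree : ℝ) ≤ h.natDegree * s := le_mul_of_one_le_right (Nat.cast_nonneg _) hs1
  have h5 := mul_le_mul_of_nonneg_left this hnR.le
  linarith

end ExtensionSums

section ExtensionSums
open Polynomial

/-- The sums of a product of multiplicative characters at the norms of `x + a t`, over the finite
extensions of a finite field, are bounded by a constant times the square root of the cardinality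
of the extension. -/
theorem exists_norm_sum_prod_mulChar_norm_le {K : Type*} [Field K] [Finite K] {ι : Type*}
    [Fintype ι] (hι : Fintype.card ι < Nat.card K) {χ : ι → MulChar K ℂ} (hχ : ∃ t, χ t ≠ 1)
    {a : ι → K} (ha : Function.Injective a) :
    ∃ C : ℝ, ∀ (E : Type*) [Field E] [Fintype E] [Algebra K E],
      ‖∑ x : E, ∏ t, χ t (Algebra.norm K (x + algebraMap K E (a t)))‖ ≤
        C * √(Fintype.card E) := by
  classical
  obtain ⟨c, hca⟩ : ∃ c : K, ∀ t, c + a t ≠ 0 := by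
    cases nonempty_fintype K
    rw [Nat.card_eq_fintype_card] at hι
    obtain ⟨c, hc⟩ : ∃ c : K, ∀ t, (fun t ↦ -a t) t ≠ c := by
      by_contra! h
      exact absurd (Fintype.card_le_of_surjective _ h) (not_le.mpr hι)
    exact ⟨c, fun t h ↦ hc t (neg_eq_of_add_eq_zero_left h)⟩
  have := MulChar.isCyclic_complex K
  have : Finite (MulChar K ℂ) := inferInstance
  obtain ⟨⟨ψ, hψH⟩, hψ⟩ := IsCyclic.exists_generator (α := Subgroup.closure (Set.range χ))
  have hk (t : ι) : ∃ k : ℕ, 0 < k ∧ χ t = ψ ^ k := by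
    have h1 := hψ ⟨χ t, Subgroup.subset_closure ⟨t, rfl⟩⟩
    obtain ⟨i, hi⟩ := mem_powers_iff_mem_zpowers.mpr h1
    refine ⟨i + orderOf ψ, Nat.add_pos_right _ (orderOf_pos ψ), ?_⟩
    rw [pow_add, pow_orderOf_eq_one, mul_one]
    exact (congrArg Subtype.val hi).symm
  choose k hk0 hk using hk
  have hψ1 : ψ ≠ 1 := by
    rintro rfl
    obtain ⟨t, ht⟩ := hχ
    exact ht (by rw [hk, one_pow])
  have hprime (l : ℕ) (hl : l.Prime) (hlψ : l ∣ orderOf ψ) : ∃ t, ¬ l ∣ k t := by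
    by_contra! hall
    have hle : Subgroup.closure (Set.range χ) ≤ Subgroup.zpowers (ψ ^ l) := by
      rw [Subgroup.closure_le]
      rintro _ ⟨t, rfl⟩
      obtain ⟨i, hi⟩ := hall t
      rw [hk, hi, pow_mul]
      exact Subgroup.npow_mem_zpowers _ _
    have h1 := orderOf_dvd_of_mem_zpowers (hle hψH)
    rw [orderOf_pow_of_dvd hl.ne_zero hlψ] at h1
    have h2 := Nat.le_of_dvd (Nat.div_pos (Nat.le_of_dvd (orderOf_pos ψ) hlψ) hl.pos) h1
    exact absurd (Nat.div_lt_self (orderOf_pos ψ) hl.one_lt) (not_lt.mpr h2)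
  set d := orderOf ψ
  set m := ∑ t, k t
  refine ⟨d * (8 * m + 2 * d * m + 12) + m, fun E _ _ _ ↦ ?_⟩
  let f (t : ι) : E[X] := (X + C (algebraMap K E (c + a t))) ^ k t
  have hf (t : ι) : (f t).Monic := (monic_X_add_C _).pow _
  have hdeg : (∏ t, f t).natDegree = m := by
    rw [natDegree_prod_of_monic _ _ fun t _ ↦ hf t]
    exact Finset.sum_congr rfl fun t _ ↦ by rw [natDegree_pow, natDegree_X_add_C, mul_one]
  have hroot (t : ι) : (∏ t, f t).rootMultiplicity (-algebraMap K E (c + a t)) = k t := by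
    have h1 : (∏ t ∈ univ.erase t, f t) ≠ 0 :=
      Finset.prod_ne_zero_iff.mpr fun i _ ↦ (hf i).ne_zero
    have h2 : f t = (X - C (-algebraMap K E (c + a t))) ^ k t := by
      rw [C_neg, sub_neg_eq_add]
    rw [← Finset.prod_erase_mul _ _ (Finset.mem_univ t), h2,
      rootMultiplicity_mul_X_sub_C_pow h1, rootMultiplicity_eq_zero, zero_add]
    rw [IsRoot.def, eval_prod, Finset.prod_eq_zero_iff]
    rintro ⟨i, hi, h3⟩
    rw [eval_pow, eval_add, eval_X, eval_C, ← map_neg, ← map_add] at h3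
    have h4 := (map_eq_zero _).mp (eq_zero_of_pow_eq_zero h3)
    exact Finset.ne_of_mem_erase hi (ha (by linear_combination h4))
  have hmain := norm_sum_mulChar_norm_eval_le (K := K) (h := ∏ t, f t) hψ1
    (monic_prod_of_monic _ _ fun t _ ↦ hf t) (by
      rw [eval_prod, Finset.prod_ne_zero_iff]
      intro t _
      rw [eval_pow, eval_add, eval_X, eval_C, zero_add]
      exact pow_ne_zero _ ((_root_.map_ne_zero _).mpr (hca t)))
    (fun l hl hld ↦ (hprime l hl hld).imp' _ fun t ht ↦ (hroot t).symm ▸ ht)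
  rw [hdeg] at hmain
  refine le_trans (le_of_eq (congrArg _ ?_)) hmain
  rw [← Equiv.sum_comp (Equiv.addRight (algebraMap K E c))]
  refine Finset.sum_congr rfl fun x _ ↦ ?_
  rw [eval_prod, map_prod, map_prod]
  refine Finset.prod_congr rfl fun t _ ↦ ?_
  rw [hk, MulChar.pow_apply' _ (hk0 t).ne', eval_pow, map_pow, map_pow]
  simp [add_assoc]

end ExtensionSums

section EulerProduct

open Polynomial UniqueFactorizationMonoid

lemma finite_monic_natDegree_eq (K : Type*) [Field K] [Finite K] (d : ℕ) :
    {f : K[X] | f.Monic ∧ f.natDegree = d}.Finite := by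
  have : Finite (degreeLT K (d + 1)) := Finite.of_equiv _ (degreeLTEquiv K (d + 1)).symm.toEquiv
  refine (Set.toFinite (degreeLT K (d + 1) : Set K[X])).subset fun f hf ↦ ?_
  rw [SetLike.mem_coe, mem_degreeLT]
  exact lt_of_le_of_lt degree_le_natDegree (by rw [hf.2]; exact_mod_cast Nat.lt_succ_self d)

/-- The monic polynomials of degree `d` over a finite field. -/
noncomputable def monicFinset (K : Type*) [Field K] [Finite K] (d : ℕ) : Finset K[X] :=
  (finite_monic_natDegree_eq K d).toFinset

variable {K : Type*} [Field K] [Finite K]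

@[simp]
lemma mem_monicFinset {d : ℕ} {f : K[X]} :
    f ∈ monicFinset K d ↔ f.Monic ∧ f.natDegree = d := by
  simp [monicFinset]

/-- The coefficients of the `L`-function of a multiplicative function on polynomials. -/
noncomputable def lCoeff (Φ : K[X] →* ℂ) (d : ℕ) : ℂ := ∑ f ∈ monicFinset K d, Φ f

lemma lCoeff_zero (Φ : K[X] →* ℂ) : lCoeff Φ 0 = 1 := by
  have : monicFinset K 0 = {1} := by
    ext f
    simp only [mem_monicFinset, Finset.mem_singleton]
    exact ⟨fun h ↦ h.1.natDegree_eq_zero.mp h.2, fun h ↦ by simp [h]⟩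
  simp [lCoeff, this]

lemma lCoeff_one [Fintype K] (Φ : K[X] →* ℂ) : lCoeff Φ 1 = ∑ x : K, Φ (X + C x) := by
  symm
  refine Finset.sum_bij (fun x _ ↦ X + C x) (fun x _ ↦ ?_) (fun x _ y _ h ↦ ?_) (fun f hf ↦ ?_)
    fun x _ ↦ rfl
  · exact mem_monicFinset.mpr ⟨monic_X_add_C x, natDegree_X_add_C x⟩
  · exact C_injective (add_left_cancel h)
  · obtain ⟨h1, h2⟩ := mem_monicFinset.mp hf
    exact ⟨f.coeff 0, Finset.mem_univ _, (h1.eq_X_add_C h2).symm⟩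

lemma lCoeff_eq_zero_of_add {d : ℕ} (Φ : K[X] →* ℂ) [Fintype K] {g : K[X]} (hg : g.natDegree < d)
    (h : ∀ f, ∑ c : K, Φ (f + C c * g) = 0) : lCoeff Φ d = 0 := by
  have hshift (c : K) : ∑ f ∈ monicFinset K d, Φ (f + C c * g) = lCoeff Φ d := by
    have hdeg (c : K) : (C c * g).natDegree < d := (natDegree_C_mul_le c g).trans_lt hg
    have hmem (c : K) {f : K[X]} (hf : f ∈ monicFinset K d) :
        f + C c * g ∈ monicFinset K d := by
      obtain ⟨h1, h2⟩ := mem_monicFinset.mp hf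
      have h3 : (C c * g).natDegree < f.natDegree := h2 ▸ hdeg c
      exact mem_monicFinset.mpr ⟨h1.add_of_left (degree_lt_degree h3),
        by rw [natDegree_add_eq_left_of_natDegree_lt h3, h2]⟩
    refine Finset.sum_bij' (fun f _ ↦ f + C c * g) (fun f _ ↦ f + C (-c) * g)
      (fun f hf ↦ hmem c hf) (fun f hf ↦ hmem _ hf) ?_ ?_ fun f _ ↦ rfl
    · intro f _
      simp
    · intro f _
      simp
  have h1 : ∑ c : K, ∑ f ∈ monicFinset K d, Φ (f + C c * g) = 0 := by
    rw [Finset.sum_comm]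
    exact Finset.sum_eq_zero fun f _ ↦ h f
  simp_rw [hshift] at h1
  rw [Finset.sum_const, smul_eq_zero] at h1
  exact h1.resolve_left (Finset.card_ne_zero.mpr Finset.univ_nonempty)

/-- The monic irreducible polynomials of degree at most `d`. -/
noncomputable def primeFinset (K : Type*) [Field K] [Finite K] (d : ℕ) : Finset K[X] :=
  open scoped Classical in {P ∈ (Finset.Icc 1 d).biUnion (monicFinset K) | Irreducible P}

lemma mem_primeFinset {d : ℕ} {P : K[X]} :
    P ∈ primeFinset K d ↔ P.Monic ∧ Irreducible P ∧ P.natDegree ≤ d := by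
  classical
  simp only [primeFinset, Finset.mem_filter, Finset.mem_biUnion, Finset.mem_Icc, mem_monicFinset]
  constructor
  · rintro ⟨⟨n, ⟨-, hn⟩, hP, hPn⟩, hi⟩
    exact ⟨hP, hi, hPn.trans_le hn⟩
  · rintro ⟨hP, hi, hn⟩
    exact ⟨⟨_, ⟨hi.natDegree_pos, hn⟩, hP, rfl⟩, hi⟩

lemma natDegree_eq_sum_pow_dvd {d : ℕ} {f : K[X]} (hf : f ∈ monicFinset K d) [DecidableEq K[X]]
    [DecidableRel ((· ∣ ·) : K[X] → K[X] → Prop)] :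
    d = ∑ P ∈ primeFinset K d, #{r ∈ Finset.Icc 1 d | P ^ r ∣ f} * P.natDegree := by
  classical
  obtain ⟨hm, hd⟩ := mem_monicFinset.mp hf
  have hmon : ∀ P ∈ normalizedFactors f, P.Monic := fun P hP ↦ by
    rw [← normalize_normalized_factor P hP]
    exact monic_normalize (irreducible_of_normalized_factor P hP).ne_zero
  have hprod : (normalizedFactors f).prod = f := by
    rw [prod_normalizedFactors_eq hm.ne_zero, hm.normalize_eq_self]
  have h1 := natDegree_multiset_prod_of_monic _ hmon
  rw [hprod, hd, Finset.sum_multiset_map_count] at h1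
  have hcount {P : K[X]} (hP : P.Monic) (hPi : Irreducible P) (r : ℕ) :
      P ^ r ∣ f ↔ r ≤ (normalizedFactors f).count P := by
    rw [pow_dvd_iff_le_emultiplicity, emultiplicity_eq_count_normalizedFactors hPi hm.ne_zero,
      hP.normalize_eq_self, Nat.cast_le]
  have hcard {P : K[X]} (hP : P.Monic) (hPi : Irreducible P) :
      #{r ∈ Finset.Icc 1 d | P ^ r ∣ f} = (normalizedFactors f).count P := by
    have h2 : (normalizedFactors f).count P ≤ d := by
      have h3 := natDegree_le_of_dvd ((hcount hP hPi _).mpr le_rfl) hm.ne_zero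
      rw [natDegree_pow, hd] at h3
      exact (Nat.le_mul_of_pos_right _ hPi.natDegree_pos).trans h3
    have h3 : {r ∈ Finset.Icc 1 d | P ^ r ∣ f} =
        Finset.Icc 1 ((normalizedFactors f).count P) := by
      ext r
      rw [Finset.mem_filter, hcount hP hPi, Finset.mem_Icc, Finset.mem_Icc]
      lia
    rw [h3, Nat.card_Icc, Nat.add_sub_cancel]
  conv_lhs => rw [h1]
  refine (Finset.sum_subset (fun P hP ↦ ?_) fun P hP hP' ↦ ?_).trans
    (Finset.sum_congr rfl fun P hP ↦ ?_)
  · rw [Multiset.mem_toFinset] at hP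
    refine mem_primeFinset.mpr ⟨hmon P hP, irreducible_of_normalized_factor P hP, ?_⟩
    rw [← hd]
    exact natDegree_le_of_dvd (dvd_of_mem_normalizedFactors hP) hm.ne_zero
  · rw [Multiset.mem_toFinset] at hP'
    rw [Multiset.count_eq_zero_of_notMem hP', zero_smul]
  · obtain ⟨h2, h3, -⟩ := mem_primeFinset.mp hP
    rw [hcard h2 h3, smul_eq_mul]

lemma sum_filter_pow_dvd (Φ : K[X] →* ℂ) {d r : ℕ} {P : K[X]} (hP : P.Monic)
    [DecidableRel ((· ∣ ·) : K[X] → K[X] → Prop)] :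
    ∑ f ∈ monicFinset K d with P ^ r ∣ f, Φ f =
      if r * P.natDegree ≤ d then Φ P ^ r * lCoeff Φ (d - r * P.natDegree) else 0 := by
  have hPr : (P ^ r).Monic := hP.pow r
  have hdeg : (P ^ r).natDegree = r * P.natDegree := natDegree_pow _ _
  split_ifs with h
  · rw [lCoeff, Finset.mul_sum]
    symm
    refine Finset.sum_bij (fun g _ ↦ P ^ r * g) (fun g hg ↦ ?_) (fun g _ g' _ h ↦ ?_)
      (fun f hf ↦ ?_) fun g _ ↦ by rw [map_mul, map_pow]
    · obtain ⟨h1, h2⟩ := mem_monicFinset.mp hg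
      rw [Finset.mem_filter, mem_monicFinset]
      refine ⟨⟨hPr.mul h1, ?_⟩, dvd_mul_right _ _⟩
      rw [hPr.natDegree_mul h1, hdeg, h2, Nat.add_sub_cancel' h]
    · exact mul_left_cancel₀ hPr.ne_zero h
    · rw [Finset.mem_filter, mem_monicFinset] at hf
      obtain ⟨⟨h1, h2⟩, g, rfl⟩ := hf
      have hg : g.Monic := hPr.of_mul_monic_left h1
      refine ⟨g, mem_monicFinset.mpr ⟨hg, ?_⟩, rfl⟩
      rw [hPr.natDegree_mul hg, hdeg] at h2
      lia
  · refine Finset.sum_eq_zero fun f hf ↦ absurd ?_ h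
    rw [Finset.mem_filter, mem_monicFinset] at hf
    rw [← hdeg, ← hf.1.2]
    exact natDegree_le_of_dvd hf.2 hf.1.1.ne_zero

/-- The Newton identities for the coefficients of an `L`-function, from the logarithmic derivative
of its Euler product. -/
theorem natCast_mul_lCoeff (Φ : K[X] →* ℂ) {S : ℕ → ℂ}
    (hS : ∀ j d, 0 < j → j ≤ d → S j = ∑ P ∈ primeFinset K d with P.natDegree ∣ j,
      P.natDegree * Φ P ^ (j / P.natDegree)) (d : ℕ) :
    d * lCoeff Φ d = ∑ j ∈ Finset.Icc 1 d, S j * lCoeff Φ (d - j) := by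
  classical
  calc d * lCoeff Φ d = ∑ f ∈ monicFinset K d, ∑ P ∈ primeFinset K d,
        ∑ r ∈ Finset.Icc 1 d, if P ^ r ∣ f then P.natDegree * Φ f else 0 := by
        rw [lCoeff, Finset.mul_sum]
        refine Finset.sum_congr rfl fun f hf ↦ ?_
        conv_lhs => rw [natDegree_eq_sum_pow_dvd hf]
        push_cast
        rw [Finset.sum_mul]
        refine Finset.sum_congr rfl fun P _ ↦ ?_
        rw [← Finset.sum_filter, Finset.sum_const, nsmul_eq_mul, mul_assoc]
    _ = ∑ P ∈ primeFinset K d, ∑ r ∈ Finset.Icc 1 d,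
        if r * P.natDegree ≤ d then
          P.natDegree * (Φ P ^ r * lCoeff Φ (d - r * P.natDegree)) else 0 := by
        rw [Finset.sum_comm]
        refine Finset.sum_congr rfl fun P hP ↦ ?_
        rw [Finset.sum_comm]
        refine Finset.sum_congr rfl fun r _ ↦ ?_
        rw [← Finset.sum_filter, ← Finset.mul_sum,
          sum_filter_pow_dvd Φ (mem_primeFinset.mp hP).1, mul_ite, mul_zero]
    _ = ∑ P ∈ primeFinset K d, ∑ j ∈ Finset.Icc 1 d, if P.natDegree ∣ j then
        P.natDegree * Φ P ^ (j / P.natDegree) * lCoeff Φ (d - j) else 0 := by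
        refine Finset.sum_congr rfl fun P hP ↦ ?_
        have hpos : 0 < P.natDegree := (mem_primeFinset.mp hP).2.1.natDegree_pos
        rw [← Finset.sum_filter, ← Finset.sum_filter]
        refine Finset.sum_bij' (fun r _ ↦ r * P.natDegree) (fun j _ ↦ j / P.natDegree)
          ?_ ?_ ?_ ?_ ?_
        · intro r hr
          rw [Finset.mem_filter, Finset.mem_Icc] at hr ⊢
          exact ⟨⟨Nat.mul_pos hr.1.1 hpos, hr.2⟩, dvd_mul_left _ _⟩
        · intro j hj
          rw [Finset.mem_filter, Finset.mem_Icc] at hj ⊢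
          refine ⟨⟨Nat.div_pos (Nat.le_of_dvd hj.1.1 hj.2) hpos,
            (Nat.div_le_self _ _).trans hj.1.2⟩, ?_⟩
          rw [Nat.div_mul_cancel hj.2]
          exact hj.1.2
        · intro r _
          exact Nat.mul_div_cancel _ hpos
        · intro j hj
          exact Nat.div_mul_cancel (Finset.mem_filter.mp hj).2
        · intro r _
          rw [Nat.mul_div_cancel _ hpos, mul_assoc]
    _ = _ := by
        rw [Finset.sum_comm]
        refine Finset.sum_congr rfl fun j hj ↦ ?_
        rw [Finset.mem_Icc] at hj
        rw [hS j d hj.1 hj.2, Finset.sum_mul, Finset.sum_filter]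

end EulerProduct

section CharacterLSeries

open Polynomial IntermediateField

lemma norm_algebraMap_sub_eq_eval_minpoly_pow {K E : Type*} [Field K] [Field E] [Algebra K E]
    [FiniteDimensional K E] (x : E) (b : K) :
    Algebra.norm K (algebraMap K E b - x) =
      (minpoly K x).eval b ^ (Module.finrank K E / (minpoly K x).natDegree) := by
  set y := x + algebraMap K E (-b) with hy
  have hyi : IsIntegral K y := Algebra.IsIntegral.isIntegral y
  have hmin : minpoly K y = (minpoly K x).comp (X - C (-b)) := minpoly.add_algebraMap _ _
  have hdeg : (minpoly K y).natDegree = (minpoly K x).natDegree := by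
    rw [hmin, natDegree_comp, natDegree_X_sub_C, mul_one]
  have hfin : Module.finrank K E = (minpoly K x).natDegree * Module.finrank K⟮y⟯ E := by
    rw [← hdeg, ← adjoin.finrank hyi, Module.finrank_mul_finrank]
  have hpos : 0 < (minpoly K x).natDegree :=
    minpoly.natDegree_pos (Algebra.IsIntegral.isIntegral x)
  have hgen : Algebra.norm K (AdjoinSimple.gen K y) =
      (-1) ^ (minpoly K x).natDegree * (minpoly K x).eval b := by
    have h1 := Algebra.PowerBasis.norm_gen_eq_coeff_zero_minpoly (adjoin.powerBasis hyi)
    rw [adjoin.powerBasis_gen, adjoin.powerBasis_dim, minpoly_gen, hdeg, hmin,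
      coeff_zero_eq_eval_zero, eval_comp] at h1
    simpa using h1
  have h2 : algebraMap K E b - x = algebraMap K E (-1) * y := by
    rw [hy, map_neg, map_neg, map_one]
    ring
  rw [h2, map_mul, Algebra.norm_algebraMap, Algebra.norm_eq_norm_adjoin, hgen, hfin,
    Nat.mul_div_cancel_left _ hpos, mul_pow, ← pow_mul, ← mul_assoc, ← mul_pow]
  simp

lemma card_filter_minpoly_eq {K E : Type*} [Field K] [Finite K] [Field E] [Fintype E]
    [Algebra K E] [DecidableEq K[X]] {P : K[X]} (hP : P.Monic) (hPi : Irreducible P)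
    (hdvd : P.natDegree ∣ Module.finrank K E) : #{x : E | minpoly K x = P} = P.natDegree := by
  classical
  cases nonempty_fintype K
  have hsplit : (P.map (algebraMap K E)).Splits := by
    have h1 := (FiniteField.isSplittingField_sub E K).splits
    refine h1.of_dvd ?_ (Polynomial.map_dvd _ ?_)
    · exact (Polynomial.map_ne_zero_iff (algebraMap K E).injective).mpr
        (FiniteField.X_pow_card_sub_X_ne_zero K Fintype.one_lt_card)
    · rw [← Nat.card_eq_fintype_card, Module.natCard_eq_pow_finrank (K := K) (V := E)]
      exact hPi.natDegree_dvd_iff_dvd_X_pow_card_pow_sub_X.mp hdvd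
  rw [← card_rootSet_eq_natDegree (PerfectField.separable_of_irreducible hPi) hsplit,
    ← Set.toFinset_card]
  congr 1
  ext x
  rw [Finset.mem_filter, Set.mem_toFinset, mem_rootSet]
  constructor
  · rintro ⟨-, rfl⟩
    exact ⟨hP.ne_zero, minpoly.aeval K x⟩
  · rintro ⟨-, h⟩
    exact ⟨Finset.mem_univ _, (minpoly.eq_of_irreducible_of_monic hPi h hP).symm⟩

lemma sum_pow_minpoly_eq {K E : Type*} [Field K] [Finite K] [Field E] [Fintype E]
    [Algebra K E] (Φ : K[X] →* ℂ) {j d : ℕ} (hj : Module.finrank K E = j) (hjd : j ≤ d)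
    [DecidableEq K[X]] :
    ∑ x : E, Φ (minpoly K x) ^ (j / (minpoly K x).natDegree) =
      ∑ P ∈ primeFinset K d with P.natDegree ∣ j, P.natDegree * Φ P ^ (j / P.natDegree) := by
  have hj0 : 0 < j := hj ▸ Module.finrank_pos
  have hmaps : ∀ x ∈ (univ : Finset E), minpoly K x ∈
      {P ∈ primeFinset K d | P.natDegree ∣ j} := fun x _ ↦ by
    have hx : IsIntegral K x := Algebra.IsIntegral.isIntegral x
    have hdvd : (minpoly K x).natDegree ∣ j := by
      rw [← hj, ← adjoin.finrank hx, ← Module.finrank_mul_finrank K K⟮x⟯ E]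
      exact dvd_mul_right _ _
    rw [Finset.mem_filter, mem_primeFinset]
    exact ⟨⟨minpoly.monic hx, minpoly.irreducible hx, (Nat.le_of_dvd hj0 hdvd).trans hjd⟩, hdvd⟩
  rw [← Finset.sum_fiberwise_of_maps_to hmaps]
  refine Finset.sum_congr rfl fun P hP ↦ ?_
  rw [Finset.mem_filter, mem_primeFinset] at hP
  rw [Finset.sum_congr (g := fun _ ↦ Φ P ^ (j / P.natDegree)) rfl fun x hx ↦ by
    rw [(Finset.mem_filter.mp hx).2], Finset.sum_const,
    card_filter_minpoly_eq hP.1.1 hP.1.2.1 (hj ▸ hP.2), nsmul_eq_mul]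

/-- The multiplicative function on polynomials attached to multiplicative characters `χ t` and
points `b t`. -/
noncomputable def evalMulChar {K ι : Type*} [Field K] [Fintype ι] (χ : ι → MulChar K ℂ)
    (b : ι → K) : K[X] →* ℂ where
  toFun f := ∏ t, χ t (f.eval (b t))
  map_one' := by simp
  map_mul' f g := by simp [Finset.prod_mul_distrib]

lemma evalMulChar_apply {K ι : Type*} [Field K] [Fintype ι] (χ : ι → MulChar K ℂ)
    (b : ι → K) (f : K[X]) : evalMulChar χ b f = ∏ t, χ t (f.eval (b t)) := rfl

lemma sum_prod_mulChar_norm_eq {K E ι : Type*} [Field K] [Finite K] [Field E] [Fintype E]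
    [Algebra K E] [Fintype ι] (χ : ι → MulChar K ℂ) (b : ι → K) :
    ∑ x : E, ∏ t, χ t (Algebra.norm K (x + algebraMap K E (b t))) =
      ∑ x : E, evalMulChar χ b (minpoly K x) ^
        (Module.finrank K E / (minpoly K x).natDegree) := by
  rw [← Equiv.sum_comp (Equiv.neg E)]
  refine Finset.sum_congr rfl fun x _ ↦ ?_
  rw [evalMulChar_apply, ← Finset.prod_pow]
  refine Finset.prod_congr rfl fun t _ ↦ ?_
  rw [← map_pow, ← norm_algebraMap_sub_eq_eval_minpoly_pow, Equiv.neg_apply, neg_add_eq_sub]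

lemma lCoeff_evalMulChar_eq_zero {K ι : Type*} [Field K] [Fintype K] [Fintype ι]
    {χ : ι → MulChar K ℂ} (hχ : ∃ t, χ t ≠ 1) {b : ι → K} (hb : Function.Injective b) {d : ℕ}
    (hd : Fintype.card ι ≤ d) : lCoeff (evalMulChar χ b) d = 0 := by
  classical
  obtain ⟨t, ht⟩ := hχ
  set g : K[X] := ∏ i ∈ univ.erase t, (X - C (b i)) with hg
  have hgt : g.eval (b t) ≠ 0 := by
    rw [hg, eval_prod, Finset.prod_ne_zero_iff]
    intro i hi
    rw [eval_sub, eval_X, eval_C, sub_ne_zero]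
    exact fun h ↦ Finset.ne_of_mem_erase hi (hb h).symm
  have hgi {i : ι} (hi : i ∈ univ.erase t) : g.eval (b i) = 0 := by
    rw [hg, eval_prod]
    exact Finset.prod_eq_zero hi (by simp)
  have hcard : 0 < Fintype.card ι := Fintype.card_pos_iff.mpr ⟨t⟩
  refine lCoeff_eq_zero_of_add _ (g := g) ?_ fun f ↦ ?_
  · rw [hg, natDegree_prod_of_monic _ _ fun i _ ↦ monic_X_sub_C _]
    simp only [natDegree_X_sub_C, Finset.sum_const, smul_eq_mul, mul_one,
      Finset.card_erase_of_mem (Finset.mem_univ t), Finset.card_univ]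
    lia
  · have h1 (c : K) : evalMulChar χ b (f + C c * g) =
        χ t (c * g.eval (b t) + f.eval (b t)) * ∏ i ∈ univ.erase t, χ i (f.eval (b i)) := by
      rw [evalMulChar_apply, ← Finset.mul_prod_erase _ _ (Finset.mem_univ t), eval_add, eval_mul,
        eval_C, add_comm]
      congr 1
      refine Finset.prod_congr rfl fun i hi ↦ ?_
      rw [eval_add, eval_mul, hgi hi, mul_zero, add_zero]
    simp_rw [h1]
    rw [← Finset.sum_mul]
    have h2 : ∑ c : K, χ t (c * g.eval (b t) + f.eval (b t)) = ∑ c : K, χ t c :=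
      ((Equiv.mulRight₀ _ hgt).trans (Equiv.addRight (f.eval (b t)))).sum_comp (χ t)
    rw [h2, MulChar.sum_eq_zero_of_ne_one ht, zero_mul]

end CharacterLSeries

section LFunctionRoots

open Polynomial Filter Topology

lemma eval_ne_zero_of_eventually_derivative_eq_mul {L : ℂ[X]} (hL : L ≠ 0) {ρ : ℂ} {G : ℂ → ℂ}
    (hG : ContinuousAt G ρ) (h : ∀ᶠ z in 𝓝 ρ, L.derivative.eval z = L.eval z * G z) :
    L.eval ρ ≠ 0 := by
  intro h0
  obtain ⟨M, hLM, hM⟩ := exists_eq_pow_rootMultiplicity_mul_and_not_dvd L hL ρ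
  have hr : 0 < L.rootMultiplicity ρ := (rootMultiplicity_pos hL).mpr h0
  obtain ⟨r, hr⟩ := Nat.exists_eq_add_of_lt hr
  rw [zero_add] at hr
  rw [hr] at hLM
  rw [dvd_iff_isRoot, IsRoot.def] at hM
  let F (z : ℂ) : ℂ := (r + 1) * M.eval z +
    (z - ρ) * (M.derivative.eval z - M.eval z * G z)
  have hF : ContinuousAt F ρ := by
    have h1 := M.continuous.continuousAt (x := ρ)
    have h2 := M.derivative.continuous.continuousAt (x := ρ)
    exact (continuousAt_const.mul h1).add
      ((continuousAt_id.sub continuousAt_const).mul (h2.sub (h1.mul hG)))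
  have hF0 : ∀ᶠ z in 𝓝[≠] ρ, F z = 0 := by
    filter_upwards [h.filter_mono nhdsWithin_le_nhds, self_mem_nhdsWithin] with z hz hzρ
    have hzρ' : z - ρ ≠ 0 := sub_ne_zero.mpr hzρ
    rw [hLM] at hz
    simp only [derivative_mul, derivative_X_sub_C_pow, eval_add, eval_mul, eval_pow, eval_sub,
      eval_X, eval_C, Nat.add_sub_cancel] at hz
    apply mul_left_cancel₀ (pow_ne_zero r hzρ')
    simp only [F]
    push_cast at hz
    linear_combination hz
  have h1 : Tendsto F (𝓝[≠] ρ) (𝓝 0) :=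
    tendsto_const_nhds.congr' (hF0.mono fun z hz ↦ hz.symm)
  have h2 := tendsto_nhds_unique (hF.tendsto.mono_left nhdsWithin_le_nhds) h1
  simp only [F, sub_self, zero_mul, add_zero] at h2
  exact hM ((mul_eq_zero.mp h2).resolve_left (by exact_mod_cast Nat.succ_ne_zero r))

lemma eval_ne_zero_of_newton {L : ℂ[X]} (hL : L ≠ 0) {S : ℕ → ℂ} {C R : ℝ} (hR : 0 < R)
    (hS : ∀ j, 0 < j → ‖S j‖ ≤ C * R ^ j)
    (hnewton : ∀ d : ℕ, d * L.coeff d = ∑ j ∈ Finset.Icc 1 d, S j * L.coeff (d - j))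
    {ρ : ℂ} (hρ : ‖ρ‖ < R⁻¹) : L.eval ρ ≠ 0 := by
  obtain ⟨t, hρt, htR⟩ := exists_between hρ
  have ht0 : 0 < t := (norm_nonneg ρ).trans_lt hρt
  let G (z : ℂ) : ℂ := ∑' m, S (m + 1) * z ^ m
  have hsum : Summable fun m : ℕ ↦ C * R * (R * t) ^ m := by
    refine (summable_geometric_of_lt_one (by positivity) ?_).mul_left _
    rwa [← lt_div_iff₀' hR, one_div]
  have hbound (m : ℕ) {z : ℂ} (hz : z ∈ Metric.closedBall (0 : ℂ) t) :
      ‖S (m + 1) * z ^ m‖ ≤ C * R * (R * t) ^ m := by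
    rw [mem_closedBall_zero_iff] at hz
    rw [norm_mul, norm_pow]
    calc ‖S (m + 1)‖ * ‖z‖ ^ m ≤ (C * R ^ (m + 1)) * t ^ m :=
          mul_le_mul (hS _ m.succ_pos) (pow_le_pow_left₀ (norm_nonneg z) hz m) (by positivity)
            ((norm_nonneg _).trans (hS _ m.succ_pos))
      _ = _ := by ring
  have hGc : ContinuousOn G (Metric.closedBall 0 t) :=
    continuousOn_tsum (fun m ↦ by fun_prop) hsum fun m z hz ↦ hbound m hz
  have hnhds : Metric.closedBall (0 : ℂ) t ∈ 𝓝 ρ :=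
    mem_of_superset (Metric.isOpen_ball.mem_nhds (mem_ball_zero_iff.mpr hρt))
      Metric.ball_subset_closedBall
  refine eval_ne_zero_of_eventually_derivative_eq_mul hL (hGc.continuousAt hnhds) ?_
  filter_upwards [hnhds] with z hz
  have hLz (p : ℂ[X]) : p.eval z = ∑' n, p.coeff n * z ^ n := by
    rw [eval_eq_sum_range, tsum_eq_sum (s := Finset.range (p.natDegree + 1))]
    intro n hn
    rw [coeff_eq_zero_of_natDegree_lt (by simpa using hn), zero_mul]
  have hLs : Summable fun n ↦ ‖L.coeff n * z ^ n‖ := by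
    refine summable_of_ne_finset_zero (s := Finset.range (L.natDegree + 1)) fun n hn ↦ ?_
    rw [coeff_eq_zero_of_natDegree_lt (by simpa using hn), zero_mul, norm_zero]
  have hGs : Summable fun m ↦ ‖S (m + 1) * z ^ m‖ :=
    hsum.of_nonneg_of_le (fun m ↦ norm_nonneg _) fun m ↦ hbound m hz
  rw [hLz L, tsum_mul_tsum_eq_tsum_sum_antidiagonal_of_summable_norm hLs hGs, hLz]
  refine tsum_congr fun n ↦ ?_
  rw [coeff_derivative, mul_comm (L.coeff (n + 1))]
  have h1 := hnewton (n + 1)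
  push_cast at h1
  rw [h1, Finset.sum_mul]
  refine Finset.sum_bij' (fun j _ ↦ (n + 1 - j, j - 1)) (fun kl _ ↦ kl.2 + 1) ?_ ?_ ?_ ?_ ?_
  · intro j hj
    rw [Finset.mem_Icc] at hj
    rw [HasAntidiagonal.mem_antidiagonal]
    omega
  · intro kl hkl
    rw [HasAntidiagonal.mem_antidiagonal] at hkl
    rw [Finset.mem_Icc]
    omega
  · intro j hj
    rw [Finset.mem_Icc] at hj
    exact Nat.sub_add_cancel hj.1
  · intro kl hkl
    rw [HasAntidiagonal.mem_antidiagonal] at hkl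
    ext <;> dsimp only <;> omega
  · intro j hj
    rw [Finset.mem_Icc] at hj
    have h2 : n = (n + 1 - j) + (j - 1) := by omega
    simp only [Nat.sub_add_cancel hj.1]
    rw [show z ^ n = z ^ (n + 1 - j) * z ^ (j - 1) by rw [← pow_add, ← h2]]
    ring

lemma norm_coeff_one_le_of_newton {c S : ℕ → ℂ} {C R : ℝ} {k : ℕ} (hR : 0 < R) (hc0 : c 0 = 1)
    (hk : 0 < k) (hck : ∀ d, k ≤ d → c d = 0) (hS : ∀ j, 0 < j → ‖S j‖ ≤ C * R ^ j)
    (hnewton : ∀ d : ℕ, d * c d = ∑ j ∈ Finset.Icc 1 d, S j * c (d - j)) :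
    ‖c 1‖ ≤ (k - 1 : ℝ) * R := by
  obtain ⟨m, rfl⟩ := Nat.exists_eq_add_of_lt hk
  rw [zero_add] at *
  rcases Nat.eq_zero_or_pos m with rfl | hm
  · rw [hck 1 le_rfl]; simp
  let L : ℂ[X] := ∑ d ∈ Finset.range (m + 1), Polynomial.C (c d) * X ^ d
  have hLc (d : ℕ) : L.coeff d = c d := by
    simp only [L, finsetSum_coeff, coeff_C_mul_X_pow, Finset.sum_ite_eq, Finset.mem_range]
    split_ifs with h
    · rfl
    · exact (hck d (not_lt.mp h)).symm
  have hL : L ≠ 0 := fun h ↦ by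
    have := hLc 0
    rw [h, hc0] at this
    simp at this
  have hLdeg : L.natDegree ≤ m := by
    refine natDegree_le_iff_coeff_eq_zero.mpr fun d hd ↦ ?_
    rw [hLc, hck d hd]
  have hnewton' (d : ℕ) : d * L.coeff d = ∑ j ∈ Finset.Icc 1 d, S j * L.coeff (d - j) := by
    simpa only [hLc] using hnewton d
  let P := reflect m L
  have hPc (d : ℕ) (hd : d ≤ m) : P.coeff d = c (m - d) := by
    rw [coeff_reflect, revAt_le hd, hLc]
  have hPdeg : P.natDegree ≤ m := (natDegree_reflect_le).trans (by simp [hLdeg])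
  have hPm : P.coeff m = 1 := by rw [hPc m le_rfl, Nat.sub_self, hc0]
  have hPmonic : P.Monic := monic_of_natDegree_le_of_coeff_eq_one m hPdeg hPm
  have hPdeg' : P.natDegree = m :=
    le_antisymm hPdeg (le_natDegree_of_ne_zero (by rw [hPm]; exact one_ne_zero))
  have hroots : ∀ w ∈ P.roots, ‖w‖ ≤ R := by
    intro w hw
    by_contra! hlt
    have hw0 : w ≠ 0 := norm_pos_iff.mp (hR.trans hlt)
    have hev := (mem_roots'.mp hw).2
    have hρ : ‖w⁻¹‖ < R⁻¹ := by
      rw [norm_inv]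
      exact inv_strictAnti₀ hR hlt
    apply eval_ne_zero_of_newton hL hR hS hnewton' hρ
    let _ : Invertible w⁻¹ := invertibleOfNonzero (inv_ne_zero hw0)
    have h := eval₂_reflect_eq_zero_iff (RingHom.id ℂ) w⁻¹ m L hLdeg
    rw [invOf_eq_inv, inv_inv] at h
    exact h.mp hev
  have h1 : c 1 = -P.roots.sum := by
    rw [← (IsAlgClosed.splits P).nextCoeff_eq_neg_sum_roots_of_monic hPmonic,
      nextCoeff_of_natDegree_pos (by omega), hPdeg', hPc _ (by omega)]
    congr 1
    omega
  rw [h1, norm_neg]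
  calc ‖P.roots.sum‖ ≤ (P.roots.map fun w ↦ ‖w‖).sum := norm_multiset_sum_le _
    _ ≤ (P.roots.map fun w ↦ ‖w‖).card • R := Multiset.sum_le_card_nsmul _ _ fun x hx ↦ by
      obtain ⟨w, hw, rfl⟩ := Multiset.mem_map.mp hx
      exact hroots w hw
    _ ≤ ((m + 1 : ℕ) - 1 : ℝ) * R := by
      rw [Multiset.card_map, nsmul_eq_mul]
      refine mul_le_mul_of_nonneg_right ?_ hR.le
      push_cast
      rw [add_sub_cancel_right]
      exact_mod_cast (card_roots' P).trans hPdeg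

/-- The Weil bound for multiplicative character sums with linear arguments. -/
theorem norm_sum_prod_mulChar_le {K ι : Type*} [Field K] [Fintype K] [Fintype ι]
    (hι : Fintype.card ι < Fintype.card K) {χ : ι → MulChar K ℂ} (hχ : ∃ t, χ t ≠ 1) {b : ι → K}
    (hb : Function.Injective b) :
    ‖∑ x : K, ∏ t, χ t (x + b t)‖ ≤ (Fintype.card ι - 1 : ℝ) * √(Fintype.card K) := by
  classical
  obtain ⟨p, hp⟩ := CharP.exists K
  have hpf : Fact p.Prime := ⟨CharP.char_is_prime K p⟩
  obtain ⟨C, hC⟩ := exists_norm_sum_prod_mulChar_norm_le (by rwa [Nat.card_eq_fintype_card]) hχ hb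
  let Φ := evalMulChar χ b
  let S (j : ℕ) : ℂ := if hj : j = 0 then 0 else
    haveI : NeZero j := ⟨hj⟩
    letI : Fintype (FiniteField.Extension K p j) := Fintype.ofFinite _
    ∑ x : FiniteField.Extension K p j, ∏ t,
      χ t (Algebra.norm K (x + algebraMap K (FiniteField.Extension K p j) (b t)))
  have hS (j : ℕ) (hj : 0 < j) : ‖S j‖ ≤ C * √(Fintype.card K) ^ j := by
    have : NeZero j := ⟨hj.ne'⟩
    let _ : Fintype (FiniteField.Extension K p j) := Fintype.ofFinite _
    have h := hC (FiniteField.Extension K p j)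
    have hcard : (Fintype.card (FiniteField.Extension K p j) : ℝ) = (Fintype.card K : ℝ) ^ j := by
      rw [← Nat.card_eq_fintype_card, FiniteField.natCard_extension, Nat.card_eq_fintype_card]
      push_cast
      rfl
    have hsqrt : √((Fintype.card K : ℝ) ^ j) = √(Fintype.card K) ^ j := by
      rw [Real.sqrt_eq_iff_mul_self_eq (by positivity) (by positivity), ← mul_pow,
        Real.mul_self_sqrt (by positivity)]
    rw [hcard, hsqrt] at h
    simpa only [S, dif_neg hj.ne'] using h
  have h1 : lCoeff Φ 1 = ∑ x : K, ∏ t, χ t (x + b t) := by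
    rw [lCoeff_one]
    refine Finset.sum_congr rfl fun x _ ↦ ?_
    simp only [Φ, evalMulChar_apply, eval_add, eval_X, eval_C, add_comm x]
  rw [← h1]
  have hpos : 0 < Fintype.card ι := Fintype.card_pos_iff.mpr ⟨hχ.choose⟩
  refine norm_coeff_one_le_of_newton (c := lCoeff Φ) (S := S) (C := C)
    (Real.sqrt_pos.mpr (by exact_mod_cast Fintype.card_pos)) (lCoeff_zero Φ) hpos
    (fun d hd ↦ lCoeff_evalMulChar_eq_zero hχ hb hd) hS (natCast_mul_lCoeff Φ fun j d hj hjd ↦ ?_)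
  have : NeZero j := ⟨hj.ne'⟩
  let _ : Fintype (FiniteField.Extension K p j) := Fintype.ofFinite _
  rw [← sum_pow_minpoly_eq (E := FiniteField.Extension K p j) Φ
    (FiniteField.finrank_extension K p j) hjd]
  simp only [S, dif_neg hj.ne']
  rw [sum_prod_mulChar_norm_eq]
  refine Finset.sum_congr rfl fun x _ ↦ ?_
  rw [FiniteField.finrank_extension]

end LFunctionRoots

section CharacterWeights

open scoped Classical in
/-- The coefficients of the indicator function of the nonzero elements that are not `l`-th
powers. -/
noncomputable def nonPowWeight (F : Type*) [Field F] (l : ℕ) (χ : MulChar F ℂ) : ℂ :=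
  (if χ = 1 then 1 else 0) - if χ ^ l = 1 then 1 / (l : ℂ) else 0

lemma nonPowWeight_one {F : Type*} [Field F] {l : ℕ} :
    nonPowWeight F l (1 : MulChar F ℂ) = 1 - 1 / (l : ℂ) := by
  simp [nonPowWeight]

lemma nonPowWeight_support {F : Type*} [Field F] {l : ℕ} {χ : MulChar F ℂ}
    (h : nonPowWeight F l χ ≠ 0) : χ ^ l = 1 := by
  by_contra hχ
  have : χ ≠ 1 := by rintro rfl; exact hχ (one_pow l)
  simp [nonPowWeight, hχ, this] at h

lemma exists_mulChar_pow_eq_one_of_not_pow {F : Type*} [Field F] [Fintype F] {l : ℕ}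
    (hl : l ∣ Fintype.card F - 1) {x : F} (hx : x ≠ 0) (h : ¬ ∃ y, y ^ l = x) :
    ∃ χ : MulChar F ℂ, χ ^ l = 1 ∧ χ x ≠ 1 := by
  classical
  obtain ⟨m, hm⟩ := hl
  have hm0 : 0 < m := by
    have := Fintype.one_lt_card (α := F)
    exact Nat.pos_of_ne_zero (by rintro rfl; omega)
  have hxm : x ^ m ≠ 1 := by
    intro hxm
    obtain ⟨y, hy⟩ := exists_pow_eq_of_pow_eq_one (G := Fˣ) (d := l) (n := m) (u := Units.mk0 x hx)
      hm0 (by rw [Nat.card_eq_fintype_card, Fintype.card_units, hm]) (by ext; simpa using hxm)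
    exact h ⟨y, by simpa using (congrArg Units.val hy).symm⟩
  obtain ⟨ψ, hψ⟩ := MulChar.exists_apply_ne_one_of_hasEnoughRootsOfUnity F ℂ hxm
  refine ⟨ψ ^ m, ?_, ?_⟩
  · rw [← pow_mul, mul_comm, ← hm, ← Fintype.card_units]
    exact MulChar.pow_card_eq_one ψ
  · rw [MulChar.pow_apply' _ hm0.ne', ← map_pow]
    exact hψ

variable {F : Type*} [Field F] [Fintype (MulChar F ℂ)]

/-- The function on a finite field with prescribed coefficients in the multiplicative
characters. -/
noncomputable def charSum (w : MulChar F ℂ → ℂ) (x : F) : ℂ := ∑ χ, w χ * χ x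

/-- Convolution on the group of multiplicative characters. -/
noncomputable def charConv (w v : MulChar F ℂ → ℂ) (χ : MulChar F ℂ) : ℂ :=
  ∑ ψ, w ψ * v (ψ⁻¹ * χ)

lemma charSum_charConv (w v : MulChar F ℂ → ℂ) (x : F) :
    charSum (charConv w v) x = charSum w x * charSum v x := by
  simp only [charSum, charConv, Finset.sum_mul]
  rw [Finset.sum_comm]
  refine Finset.sum_congr rfl fun ψ _ ↦ ?_
  rw [← Equiv.sum_comp (Equiv.mulLeft ψ), Finset.mul_sum]
  refine Finset.sum_congr rfl fun χ _ ↦ ?_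
  rw [Equiv.coe_mulLeft, inv_mul_cancel_left, MulChar.mul_apply]
  ring

lemma sum_norm_charConv_le (w v : MulChar F ℂ → ℂ) :
    ∑ χ, ‖charConv w v χ‖ ≤ (∑ χ, ‖w χ‖) * ∑ χ, ‖v χ‖ := by
  calc ∑ χ, ‖charConv w v χ‖ ≤ ∑ χ, ∑ ψ, ‖w ψ‖ * ‖v (ψ⁻¹ * χ)‖ := by
        refine Finset.sum_le_sum fun χ _ ↦ (norm_sum_le _ _).trans_eq ?_
        simp only [norm_mul]
    _ = _ := by
        rw [Finset.sum_comm, Finset.sum_mul]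
        refine Finset.sum_congr rfl fun ψ _ ↦ ?_
        rw [← Finset.mul_sum]
        congr 1
        exact Equiv.sum_comp (Equiv.mulLeft ψ⁻¹) fun χ ↦ ‖v χ‖

lemma charConv_one {w v : MulChar F ℂ → ℂ} {a b : ℕ} (hab : a.Coprime b)
    (hw : ∀ χ, w χ ≠ 0 → χ ^ a = 1) (hv : ∀ χ, v χ ≠ 0 → χ ^ b = 1) :
    charConv w v 1 = w 1 * v 1 := by
  rw [charConv, Finset.sum_eq_single 1]
  · simp
  · intro ψ _ hψ
    by_contra h
    rw [mul_one] at h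
    have ha := hw ψ (left_ne_zero_of_mul h)
    have hb := hv ψ⁻¹ (right_ne_zero_of_mul h)
    rw [inv_pow, inv_eq_one] at hb
    apply hψ
    have := pow_gcd_eq_one.mpr ⟨ha, hb⟩
    rwa [hab.gcd_eq_one, pow_one] at this
  · simp

lemma charConv_support {w v : MulChar F ℂ → ℂ} {a b : ℕ}
    (hw : ∀ χ, w χ ≠ 0 → χ ^ a = 1) (hv : ∀ χ, v χ ≠ 0 → χ ^ b = 1) {χ : MulChar F ℂ}
    (h : charConv w v χ ≠ 0) : χ ^ (a * b) = 1 := by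
  obtain ⟨ψ, -, hψ⟩ := Finset.exists_ne_zero_of_sum_ne_zero h
  have ha := hw ψ (left_ne_zero_of_mul hψ)
  have hb := hv _ (right_ne_zero_of_mul hψ)
  have hχ : χ = ψ * (ψ⁻¹ * χ) := (mul_inv_cancel_left ψ χ).symm
  rw [hχ, mul_pow, pow_mul, ha, one_pow, one_mul, mul_comm a, pow_mul, hb, one_pow]

lemma charConv_mul_right {w v : MulChar F ℂ → ℂ} {η : MulChar F ℂ}
    (hv : ∀ χ, v (χ * η) = -v χ) (χ : MulChar F ℂ) :
    charConv w v (χ * η) = -charConv w v χ := by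
  simp only [charConv, ← mul_assoc, hv, mul_neg, Finset.sum_neg_distrib]

lemma charConv_mul_right_of_left {w v : MulChar F ℂ → ℂ} {η : MulChar F ℂ}
    (hw : ∀ χ, w (χ * η) = -w χ) (χ : MulChar F ℂ) :
    charConv w v (χ * η) = -charConv w v χ := by
  rw [charConv, ← Equiv.sum_comp (Equiv.mulRight η), charConv, ← Finset.sum_neg_distrib]
  refine Finset.sum_congr rfl fun ψ _ ↦ ?_
  rw [Equiv.coe_mulRight, hw, neg_mul]
  congr 3
  rw [mul_inv, mul_comm χ, mul_assoc, inv_mul_cancel_left]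

variable [Fintype F]

open scoped Classical in
lemma card_pow_eq_one_mulChar {l : ℕ} (hl : l ∣ Fintype.card F - 1) :
    #{χ : MulChar F ℂ | χ ^ l = 1} = l := by
  have := MulChar.isCyclic_complex F
  have hcard : Nat.card (MulChar F ℂ) = Fintype.card F - 1 := by
    rw [MulChar.card_eq_card_units_of_hasEnoughRootsOfUnity, Nat.card_eq_fintype_card,
      Fintype.card_units]
  simpa using card_pow_eq_pow (by rwa [hcard]) (1 : MulChar F ℂ)

open scoped Classical in
lemma sum_mulChar_pow_eq_one {l : ℕ} (hl0 : 0 < l) (hl : l ∣ Fintype.card F - 1) (x : F) :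
    ∑ χ : MulChar F ℂ with χ ^ l = 1, χ x = if x ≠ 0 ∧ ∃ y, y ^ l = x then (l : ℂ) else 0 := by
  split_ifs with h
  · obtain ⟨hx, y, rfl⟩ := h
    have hy : IsUnit y := by
      rw [isUnit_iff_ne_zero]
      rintro rfl
      exact hx (zero_pow hl0.ne')
    rw [Finset.sum_congr rfl fun χ hχ ↦ ?_, Finset.sum_const, card_pow_eq_one_mulChar hl,
      nsmul_one]
    rw [map_pow, ← MulChar.pow_apply' _ hl0.ne', (Finset.mem_filter.mp hχ).2,
      MulChar.one_apply hy]
  · rw [not_and] at h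
    rcases eq_or_ne x 0 with rfl | hx
    · exact Finset.sum_eq_zero fun χ _ ↦ χ.map_zero
    obtain ⟨ψ, hψl, hψ⟩ := exists_mulChar_pow_eq_one_of_not_pow hl hx (h hx)
    have h1 : ∑ χ : MulChar F ℂ with χ ^ l = 1, χ x =
        ψ x * ∑ χ : MulChar F ℂ with χ ^ l = 1, χ x := by
      rw [Finset.mul_sum]
      refine Finset.sum_bij' (fun χ _ ↦ ψ⁻¹ * χ) (fun χ _ ↦ ψ * χ) ?_ ?_ ?_ ?_ ?_
      · intro χ hχ
        rw [Finset.mem_filter] at hχ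
        simp [mul_pow, hψl, hχ.2]
      · intro χ hχ
        rw [Finset.mem_filter] at hχ
        simp [mul_pow, hψl, hχ.2]
      · simp
      · simp
      · intro χ hχ
        rw [← MulChar.mul_apply, mul_inv_cancel_left]
    by_contra h0
    exact hψ (mul_right_cancel₀ h0 (by rw [← h1, one_mul]))

open scoped Classical in
lemma charSum_nonPowWeight {l : ℕ} (hl0 : 0 < l) (hl : l ∣ Fintype.card F - 1) (x : F) :
    charSum (nonPowWeight F l) x = if x ≠ 0 ∧ ¬ ∃ y, y ^ l = x then 1 else 0 := by
  have h := sum_mulChar_pow_eq_one hl0 hl x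
  have hl' : (l : ℂ) ≠ 0 := by exact_mod_cast hl0.ne'
  simp only [charSum, nonPowWeight, sub_mul, Finset.sum_sub_distrib, ite_mul, zero_mul, one_mul,
    Finset.sum_ite_eq', Finset.mem_univ, if_true]
  rw [← Finset.sum_filter, ← Finset.mul_sum, h]
  rcases eq_or_ne x 0 with rfl | hx
  · simp [MulChar.map_zero]
  · rw [MulChar.one_apply hx.isUnit]
    by_cases hy : ∃ y, y ^ l = x <;> simp [hx, hy, hl']

open scoped Classical in
lemma sum_norm_nonPowWeight_ne_one {l : ℕ} (hl0 : 0 < l) (hl : l ∣ Fintype.card F - 1) :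
    ∑ χ ∈ univ.erase (1 : MulChar F ℂ), ‖nonPowWeight F l χ‖ = 1 - 1 / (l : ℝ) := by
  have h : ∀ χ ∈ univ.erase (1 : MulChar F ℂ),
      ‖nonPowWeight F l χ‖ = if χ ^ l = 1 then 1 / (l : ℝ) else 0 := by
    intro χ hχ
    simp only [nonPowWeight, if_neg (Finset.ne_of_mem_erase hχ)]
    split_ifs <;> simp
  have h1 := Finset.add_sum_erase univ (fun χ : MulChar F ℂ ↦ if χ ^ l = 1 then 1 / (l : ℝ) else 0)
    (Finset.mem_univ 1)
  have h2 : ∑ χ : MulChar F ℂ, (if χ ^ l = 1 then 1 / (l : ℝ) else 0) = 1 := by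
    rw [← Finset.sum_filter, Finset.sum_const, card_pow_eq_one_mulChar hl, nsmul_eq_mul,
      mul_one_div_cancel (by exact_mod_cast hl0.ne')]
  rw [h2, one_pow, if_pos rfl] at h1
  rw [Finset.sum_congr rfl h]
  linarith

lemma nonPowWeight_two_mul (hF : 2 ∣ Fintype.card F - 1) {η : MulChar F ℂ} (hη : η ≠ 1)
    (hη2 : η ^ 2 = 1) (χ : MulChar F ℂ) : nonPowWeight F 2 (χ * η) = -nonPowWeight F 2 χ := by
  classical
  have hset : ({χ | χ ^ 2 = 1} : Finset (MulChar F ℂ)) = {1, η} := by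
    symm
    apply Finset.eq_of_subset_of_card_le
    · intro χ
      simp only [Finset.mem_insert, Finset.mem_singleton, Finset.mem_filter, Finset.mem_univ,
        true_and]
      rintro (rfl | rfl)
      · exact one_pow 2
      · exact hη2
    · rw [card_pow_eq_one_mulChar hF, Finset.card_pair hη.symm]
  have hmem (χ : MulChar F ℂ) : χ ^ 2 = 1 ↔ χ = 1 ∨ χ = η := by
    simpa using Finset.ext_iff.mp hset χ
  have hηinv : χ * η = 1 ↔ χ = η := by
    rw [mul_eq_one_iff_eq_inv, inv_eq_of_mul_eq_one_right (by rw [← sq, hη2])]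
  simp only [nonPowWeight, mul_pow, hη2, mul_one, hmem, hηinv]
  by_cases h1 : χ = 1
  · subst h1
    simp [hη.symm]
    norm_num
  · by_cases h2 : χ = η
    · simp [h2, hη]
      norm_num
    · simp [h1, h2]

open scoped Classical in
lemma exists_nonPow_weight (s : Finset ℕ) (hs : ∀ l ∈ s, l.Prime)
    (hsF : ∀ l ∈ s, l ∣ Fintype.card F - 1) :
    ∃ w : MulChar F ℂ → ℂ,
      (∀ x ≠ 0, charSum w x = if ∀ l ∈ s, ¬ ∃ y, y ^ l = x then 1 else 0) ∧
      charSum w 0 = 0 ∧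
      w 1 = ((∏ l ∈ s, (1 - 1 / (l : ℝ)) : ℝ) : ℂ) ∧
      ∑ χ, ‖w χ‖ ≤ 2 ^ #s * ∏ l ∈ s, (1 - 1 / (l : ℝ)) ∧
      (∀ χ, w χ ≠ 0 → χ ^ (∏ l ∈ s, l) = 1) ∧
      (2 ∈ s → ∀ η : MulChar F ℂ, η ≠ 1 → η ^ 2 = 1 → ∀ χ, w (χ * η) = -w χ) := by
  induction s using Finset.induction_on with
  | empty =>
    refine ⟨fun χ ↦ if χ = 1 then 1 else 0, ?_, ?_, ?_, ?_, ?_, ?_⟩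
    · intro x hx
      simp [charSum, MulChar.one_apply hx.isUnit]
    · simp [charSum, MulChar.map_zero]
    · simp
    · simp [apply_ite]
    · intro χ
      simp
    · simp
  | insert l s hls ih =>
    obtain ⟨w, hw, hw0, hw1, hwn, hws, hw2⟩ :=
      ih (fun l hl ↦ hs l (Finset.mem_insert_of_mem hl))
        (fun l hl ↦ hsF l (Finset.mem_insert_of_mem hl))
    have hlp := hs l (Finset.mem_insert_self l s)
    have hlF := hsF l (Finset.mem_insert_self l s)
    have hcop : l.Coprime (∏ l ∈ s, l) := Nat.Coprime.prod_right fun m hm ↦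
      (Nat.coprime_primes hlp (hs m (Finset.mem_insert_of_mem hm))).mpr
        (by rintro rfl; exact hls hm)
    refine ⟨charConv (nonPowWeight F l) w, ?_, ?_, ?_, ?_, ?_, ?_⟩
    · intro x hx
      rw [charSum_charConv, hw x hx, charSum_nonPowWeight hlp.pos hlF]
      simp only [Finset.forall_mem_insert]
      by_cases h1 : ∃ y, y ^ l = x <;> simp [h1, hx]
    · rw [charSum_charConv, hw0, mul_zero]
    · rw [charConv_one hcop (fun χ ↦ nonPowWeight_support) hws, nonPowWeight_one, hw1,
        Finset.prod_insert hls]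
      push_cast
      rfl
    · refine (sum_norm_charConv_le _ _).trans ?_
      rw [Finset.prod_insert hls, Finset.card_insert_of_notMem hls,
        ← Finset.add_sum_erase _ _ (Finset.mem_univ 1), sum_norm_nonPowWeight_ne_one hlp.pos hlF,
        nonPowWeight_one]
      have hl1 : (0 : ℝ) ≤ 1 - 1 / l := by
        rw [sub_nonneg, div_le_one (by exact_mod_cast hlp.pos)]
        exact_mod_cast hlp.one_le
      have hn : ‖(1 - 1 / l : ℂ)‖ = 1 - 1 / (l : ℝ) := by
        rw [show (1 - 1 / l : ℂ) = ((1 - 1 / l : ℝ) : ℂ) by push_cast; rfl, Complex.norm_real,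
          Real.norm_of_nonneg hl1]
      rw [hn]
      calc _ ≤ (1 - 1 / (l : ℝ) + (1 - 1 / l)) * (2 ^ #s * ∏ l ∈ s, (1 - 1 / (l : ℝ))) :=
            mul_le_mul_of_nonneg_left hwn (by linarith)
        _ = _ := by ring
    · intro χ hχ
      rw [Finset.prod_insert hls]
      exact charConv_support (fun χ ↦ nonPowWeight_support) hws hχ
    · intro h2 η hη hη2 χ
      rcases Finset.mem_insert.mp h2 with rfl | h2
      · exact charConv_mul_right_of_left (nonPowWeight_two_mul hlF hη hη2) χ
      · exact charConv_mul_right (hw2 h2 η hη hη2) χ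

end CharacterWeights

section ConsecutiveSums

lemma norm_sum_prod_mulChar_sub_le {F : Type*} [Field F] [Fintype F]
    [DecidableEq (MulChar F ℂ)] {n : ℕ} (hn : 2 ≤ n)
    (hnF : n < Fintype.card F) (hF : 4 ≤ Fintype.card F)
    (hinj : Function.Injective fun k : Fin n ↦ ((k : ℕ) : F)) (χ : Fin n → MulChar F ℂ) :
    ‖∑ x : F, ∏ k, χ k (x + (k : ℕ)) - if ∀ k, χ k = 1 then (Fintype.card F : ℂ) else 0‖ ≤
      (n - 1 : ℝ) * √(Fintype.card F) := by
  classical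
  split_ifs with h
  · have h1 (x : F) : ‖∏ k, χ k (x + (k : ℕ)) - 1‖ ≤
        ∑ k : Fin n, if x = -((k : ℕ) : F) then 1 else 0 := by
      by_cases hx : ∃ k : Fin n, x = -((k : ℕ) : F)
      · obtain ⟨k, hk⟩ := hx
        rw [Finset.prod_eq_zero (Finset.mem_univ k) (by rw [hk, neg_add_cancel, MulChar.map_zero])]
        rw [zero_sub, norm_neg, norm_one]
        refine le_trans ?_ (Finset.single_le_sum (fun i _ ↦ ?_) (Finset.mem_univ k))
        · rw [if_pos hk]
        · split_ifs <;> norm_num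
      · push Not at hx
        rw [Finset.prod_eq_one fun k _ ↦ ?_]
        · simp only [sub_self, norm_zero]
          exact Finset.sum_nonneg fun i _ ↦ by split_ifs <;> norm_num
        · rw [h k, MulChar.one_apply]
          rw [isUnit_iff_ne_zero, Ne, add_eq_zero_iff_eq_neg]
          exact hx k
    have h2 : (2 : ℝ) ≤ √(Fintype.card F) := by
      rw [Real.le_sqrt (by norm_num) (by positivity)]
      norm_num
      exact_mod_cast hF
    have hn' : (2 : ℝ) ≤ n := by exact_mod_cast hn
    calc _ = ‖∑ x : F, (∏ k, χ k (x + (k : ℕ)) - 1)‖ := by simp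
      _ ≤ ∑ x : F, ∑ k : Fin n, if x = -((k : ℕ) : F) then (1 : ℝ) else 0 :=
        (norm_sum_le _ _).trans (Finset.sum_le_sum fun x _ ↦ h1 x)
      _ = n := by rw [Finset.sum_comm]; simp
      _ ≤ _ := by nlinarith
  · push Not at h
    have := norm_sum_prod_mulChar_le (by rwa [Fintype.card_fin]) h hinj
    simpa using this

lemma mulChar_apply_neg_one {F : Type*} [Field F] (χ : MulChar F ℂ) :
    ∃ ε : ℝ, χ (-1) = ε ∧ (ε = 1 ∨ ε = -1) := by
  have h : χ (-1) * χ (-1) = 1 := by rw [← map_mul, neg_one_mul, neg_neg, map_one]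
  rcases mul_self_eq_one_iff.mp h with h | h
  · exact ⟨1, by simp [h]⟩
  · exact ⟨-1, by simp [h]⟩

variable {F : Type*} [Field F] [Fintype F] [Fintype (MulChar F ℂ)] {n : ℕ}

/-- The sum over a finite field of a product of functions at consecutive points, the functions
being given by their coefficients in the multiplicative characters. -/
noncomputable def shiftSum (w : Fin n → MulChar F ℂ → ℂ) : ℂ :=
  ∑ x : F, ∏ k, charSum (w k) (x + (k : ℕ))

lemma shiftSum_eq_sum (w : Fin n → MulChar F ℂ → ℂ) :
    shiftSum w = ∑ χ : Fin n → MulChar F ℂ,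
      (∏ k, w k (χ k)) * ∑ x : F, ∏ k, χ k (x + (k : ℕ)) := by
  classical
  simp only [shiftSum, charSum, Fintype.prod_sum, Finset.mul_sum, Finset.prod_mul_distrib]
  exact Finset.sum_comm

lemma shiftSum_rev (w : Fin n → MulChar F ℂ → ℂ) :
    shiftSum (fun k ↦ w k.rev) = shiftSum fun k χ ↦ w k χ * χ (-1) := by
  simp only [shiftSum]
  rw [← Equiv.sum_comp (Equiv.subLeft (-((n : F) - 1)))]
  refine Finset.sum_congr rfl fun x _ ↦ ?_
  rw [← Equiv.prod_comp Fin.revPerm]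
  refine Finset.prod_congr rfl fun k _ ↦ ?_
  have h : Equiv.subLeft (-((n : F) - 1)) x + ((k.rev : ℕ) : F) = -1 * (x + (k : ℕ)) := by
    rw [Equiv.subLeft_apply, Fin.val_rev, Nat.cast_sub k.isLt]
    push_cast
    ring
  simp only [Fin.revPerm_apply, Fin.rev_rev, h, charSum, map_mul, mul_assoc]

theorem norm_shiftSum_add_rev_sub_le (hn : 2 ≤ n) (hnF : n < Fintype.card F)
    (hF : 4 ≤ Fintype.card F) (hinj : Function.Injective fun k : Fin n ↦ ((k : ℕ) : F))
    {w : Fin n → MulChar F ℂ → ℂ} (hw : ∃ k, ∑ χ, ‖w k χ‖ * (χ (-1)).re = 0) {B : ℝ}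
    (hB : ∏ k, ∑ χ, ‖w k χ‖ ≤ B) :
    ‖shiftSum w + shiftSum (fun k ↦ w k.rev) - 2 * Fintype.card F * ∏ k, w k 1‖ ≤
      (n - 1 : ℝ) * √(Fintype.card F) * B := by
  classical
  choose ε hε hε1 using mulChar_apply_neg_one (F := F)
  have hn1 : (0 : ℝ) ≤ n - 1 := by
    rw [sub_nonneg]
    exact_mod_cast (by omega : 1 ≤ n)
  have h1 : shiftSum w + shiftSum (fun k ↦ w k.rev) - 2 * Fintype.card F * ∏ k, w k 1 =
      ∑ χ : Fin n → MulChar F ℂ, (∏ k, w k (χ k)) * ((1 + ∏ k, ε (χ k) : ℝ) : ℂ) *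
        (∑ x : F, ∏ k, χ k (x + (k : ℕ)) -
          if ∀ k, χ k = 1 then (Fintype.card F : ℂ) else 0) := by
    have hmain : ∑ χ : Fin n → MulChar F ℂ, (∏ k, w k (χ k)) * ((1 + ∏ k, ε (χ k) : ℝ) : ℂ) *
        (if ∀ k, χ k = 1 then (Fintype.card F : ℂ) else 0) =
          2 * Fintype.card F * ∏ k, w k 1 := by
      rw [Finset.sum_eq_single fun _ ↦ 1]
      · have hone : ε 1 = 1 := by
          have := hε 1
          rw [MulChar.one_apply isUnit_one.neg] at this
          exact_mod_cast this.symm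
        simp [hone]
        ring
      · intro χ _ hχ
        rw [if_neg fun h ↦ hχ (funext h), mul_zero]
      · simp
    rw [shiftSum_rev, shiftSum_eq_sum, shiftSum_eq_sum, ← hmain, ← Finset.sum_add_distrib,
      ← Finset.sum_sub_distrib]
    refine Finset.sum_congr rfl fun χ _ ↦ ?_
    simp only [Finset.prod_mul_distrib, hε]
    push_cast
    ring
  rw [h1]
  calc _ ≤ ∑ χ : Fin n → MulChar F ℂ, (∏ k, ‖w k (χ k)‖) * (1 + ∏ k, ε (χ k)) *
        ((n - 1 : ℝ) * √(Fintype.card F)) := by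
        refine (norm_sum_le _ _).trans (Finset.sum_le_sum fun χ _ ↦ ?_)
        have h0 : 0 ≤ 1 + ∏ k, ε (χ k) := by
          have : |∏ k, ε (χ k)| = 1 := by
            rw [Finset.abs_prod]
            refine Finset.prod_eq_one fun k _ ↦ ?_
            rcases hε1 (χ k) with h | h <;> simp [h]
          have := neg_abs_le (∏ k, ε (χ k))
          linarith
        rw [norm_mul, norm_mul, norm_prod, Complex.norm_real, Real.norm_of_nonneg h0]
        exact mul_le_mul_of_nonneg_left (norm_sum_prod_mulChar_sub_le hn hnF hF hinj χ)
          (by positivity)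
    _ = (n - 1 : ℝ) * √(Fintype.card F) *
        (∏ k, ∑ χ, ‖w k χ‖ + ∏ k, ∑ χ, ‖w k χ‖ * (χ (-1)).re) := by
        simp only [hε, Complex.ofReal_re]
        rw [Fintype.prod_sum, Fintype.prod_sum, ← Finset.sum_add_distrib, Finset.mul_sum]
        refine Finset.sum_congr rfl fun χ _ ↦ ?_
        rw [Finset.prod_mul_distrib]
        ring
    _ ≤ _ := by
        obtain ⟨k, hk⟩ := hw
        rw [Finset.prod_eq_zero (f := fun k ↦ ∑ χ, ‖w k χ‖ * (χ (-1)).re) (Finset.mem_univ k) hk,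
          add_zero]
        exact mul_le_mul_of_nonneg_left hB (by positivity)

end ConsecutiveSums

section Sieve

lemma exists_mulChar_neg_one_eq_neg_one {F : Type*} [Field F] [Fintype F]
    (hF : Fintype.card F % 4 = 3) : ∃ η : MulChar F ℂ, η ≠ 1 ∧ η ^ 2 = 1 ∧ η (-1) = -1 := by
  classical
  have hF2 : ringChar F ≠ 2 := by
    intro h
    have := FiniteField.even_card_of_char_two h
    omega
  let η := (quadraticChar F).ringHomComp (Int.castRingHom ℂ)
  have h1 : η (-1) = -1 := by
    rw [MulChar.ringHomComp_apply, quadraticChar_neg_one hF2, ZMod.χ₄_nat_three_mod_four hF]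
    simp
  refine ⟨η, fun h ↦ ?_, ?_, h1⟩
  · rw [h, MulChar.one_apply isUnit_one.neg] at h1
    norm_num at h1
  · ext x
    rw [MulChar.pow_apply_coe, MulChar.one_apply_coe, MulChar.ringHomComp_apply, ← map_pow,
      quadraticChar_sq_one x.ne_zero, map_one]

open scoped Classical in
/-- The coefficients of the indicator function of the nonzero elements that are not `l`-th
powers, with the trivial character removed. -/
noncomputable def nontrivialNonPowWeight (F : Type*) [Field F] (l : ℕ) (χ : MulChar F ℂ) : ℂ :=
  if χ = 1 then 0 else nonPowWeight F l χ

variable {F : Type*} [Field F] [Fintype (MulChar F ℂ)]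

lemma sum_norm_mul_re_eq_zero {w : MulChar F ℂ → ℂ} {η : MulChar F ℂ} (hη : η (-1) = -1)
    (hw : ∀ χ, w (χ * η) = -w χ) : ∑ χ, ‖w χ‖ * (χ (-1)).re = 0 := by
  have h : ∑ χ, ‖w χ‖ * (χ (-1)).re = -∑ χ, ‖w χ‖ * (χ (-1)).re := by
    conv_lhs => rw [← Equiv.sum_comp (Equiv.mulRight η)]
    rw [← Finset.sum_neg_distrib]
    refine Finset.sum_congr rfl fun χ _ ↦ ?_
    rw [Equiv.coe_mulRight, hw, norm_neg, MulChar.mul_apply, hη]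
    simp
  linarith

variable [Fintype F] {n : ℕ}

lemma shiftSum_update [DecidableEq (Fin n)] (w v : MulChar F ℂ → ℂ) (j : Fin n) :
    shiftSum (Function.update (fun _ ↦ w) j (charConv v w)) =
      ∑ x : F, (∏ k : Fin n, charSum w (x + (k : ℕ))) * charSum v (x + (j : ℕ)) := by
  refine Finset.sum_congr rfl fun x _ ↦ ?_
  have h (k : Fin n) : charSum (Function.update (fun _ ↦ w) j (charConv v w) k) (x + (k : ℕ)) =
      charSum w (x + (k : ℕ)) * if k = j then charSum v (x + (k : ℕ)) else 1 := by
    rcases eq_or_ne k j with rfl | hk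
    · rw [Function.update_self, charSum_charConv, if_pos rfl, mul_comm]
    · rw [Function.update_of_ne hk, if_neg hk, mul_one]
  simp only [h, Finset.prod_mul_distrib, Finset.prod_ite_eq', Finset.mem_univ, if_true]

lemma norm_sum_shiftSum_update_le (hn : 2 ≤ n) (hnF : n < Fintype.card F)
    (hF : 4 ≤ Fintype.card F) (hinj : Function.Injective fun k : Fin n ↦ ((k : ℕ) : F))
    {w v : MulChar F ℂ → ℂ} (hw : ∑ χ, ‖w χ‖ * (χ (-1)).re = 0) (hv : charConv v w 1 = 0)
    {B b : ℝ} (hB : ∑ χ, ‖w χ‖ ≤ B) (hb : ∑ χ, ‖v χ‖ ≤ b) :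
    ‖∑ j, shiftSum (Function.update (fun _ : Fin n ↦ w) j (charConv v w))‖ ≤
      n * b * ((n - 1 : ℝ) / 2 * √(Fintype.card F) * B ^ n) := by
  let u (j : Fin n) : Fin n → MulChar F ℂ → ℂ := Function.update (fun _ ↦ w) j (charConv v w)
  change ‖∑ j, shiftSum (u j)‖ ≤ _
  have hrev (j : Fin n) : (fun k ↦ u j k.rev) = u j.rev := by
    funext k
    simp only [u, Function.update_apply, Fin.rev_eq_iff]
  have hB0 : 0 ≤ B := le_trans (by positivity) hB
  have hb0 : 0 ≤ b := le_trans (by positivity) hb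
  have hj (j : Fin n) : ‖shiftSum (u j) + shiftSum (u j.rev)‖ ≤
      (n - 1 : ℝ) * √(Fintype.card F) * (b * B ^ n) := by
    have hprod : ∏ k, u j k 1 = 0 :=
      Finset.prod_eq_zero (Finset.mem_univ j) (by simp only [u, Function.update_self, hv])
    have hk : ∃ k, ∑ χ, ‖u j k χ‖ * (χ (-1)).re = 0 := by
      have : Nontrivial (Fin n) := Fin.nontrivial_iff_two_le.mpr hn
      obtain ⟨k, hk⟩ := exists_ne j
      refine ⟨k, ?_⟩
      simp only [u, Function.update_of_ne hk, hw]
    have hle : ∏ k, ∑ χ, ‖u j k χ‖ ≤ b * B ^ n := by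
      calc ∏ k, ∑ χ, ‖u j k χ‖ ≤ ∏ k : Fin n, (if k = j then b else 1) * B := by
            refine Finset.prod_le_prod (fun k _ ↦ by positivity) fun k _ ↦ ?_
            rcases eq_or_ne k j with rfl | hk
            · simp only [u, Function.update_self, if_true]
              exact (sum_norm_charConv_le v w).trans (mul_le_mul hb hB (by positivity) hb0)
            · simpa only [u, Function.update_of_ne hk, if_neg hk, one_mul] using hB
        _ = _ := by
            rw [Finset.prod_mul_distrib]
            simp
    have h := norm_shiftSum_add_rev_sub_le hn hnF hF hinj hk hle
    rwa [hrev, hprod, mul_zero, sub_zero] at h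
  have hsum : (2 : ℂ) * ∑ j, shiftSum (u j) = ∑ j, (shiftSum (u j) + shiftSum (u j.rev)) := by
    rw [Finset.sum_add_distrib, two_mul]
    congr 1
    exact (Equiv.sum_comp Fin.revPerm fun j ↦ shiftSum (u j)).symm
  have h2 : 2 * ‖∑ j, shiftSum (u j)‖ ≤ n * ((n - 1 : ℝ) * √(Fintype.card F) * (b * B ^ n)) := by
    calc 2 * ‖∑ j, shiftSum (u j)‖ = ‖∑ j, (shiftSum (u j) + shiftSum (u j.rev))‖ := by
          rw [← hsum, norm_mul]
          simp
      _ ≤ ∑ j : Fin n, (n - 1 : ℝ) * √(Fintype.card F) * (b * B ^ n) :=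
          (norm_sum_le _ _).trans (Finset.sum_le_sum fun j _ ↦ hj j)
      _ = _ := by simp
  linarith

lemma sum_norm_nontrivialNonPowWeight {l : ℕ} (hl0 : 0 < l) (hl : l ∣ Fintype.card F - 1) :
    ∑ χ : MulChar F ℂ, ‖nontrivialNonPowWeight F l χ‖ = 1 - 1 / (l : ℝ) := by
  classical
  rw [← sum_norm_nonPowWeight_ne_one hl0 hl, ← Finset.add_sum_erase _ _ (Finset.mem_univ 1)]
  rw [nontrivialNonPowWeight, if_pos rfl, norm_zero, zero_add]
  refine Finset.sum_congr rfl fun χ hχ ↦ ?_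
  rw [nontrivialNonPowWeight, if_neg (Finset.ne_of_mem_erase hχ)]

open scoped Classical in
lemma charSum_nontrivialNonPowWeight {l : ℕ} (hl0 : 0 < l) (hl : l ∣ Fintype.card F - 1) {x : F}
    (hx : x ≠ 0) : charSum (nontrivialNonPowWeight F l) x =
      ((1 / l - (if ∃ y, y ^ l = x then 1 else 0) : ℝ) : ℂ) := by
  have h := charSum_nonPowWeight hl0 hl x
  rw [charSum, ← Finset.add_sum_erase _ _ (Finset.mem_univ 1), nonPowWeight_one,
    MulChar.one_apply hx.isUnit, mul_one] at h
  rw [charSum, ← Finset.add_sum_erase _ _ (Finset.mem_univ 1), nontrivialNonPowWeight, if_pos rfl,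
    zero_mul, zero_add, Finset.sum_congr rfl fun χ hχ ↦ by
      rw [nontrivialNonPowWeight, if_neg (Finset.ne_of_mem_erase hχ)]]
  rw [eq_sub_of_add_eq' h]
  by_cases hy : ∃ y, y ^ l = x <;> simp [hy, hx]

lemma charConv_nontrivialNonPowWeight_one {w : MulChar F ℂ → ℂ} {l m : ℕ} (hlm : l.Coprime m)
    (hw : ∀ χ, w χ ≠ 0 → χ ^ m = 1) : charConv (nontrivialNonPowWeight F l) w 1 = 0 := by
  rw [charConv_one hlm _ hw]
  · rw [nontrivialNonPowWeight, if_pos rfl, zero_mul]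
  · intro χ hχ
    rw [nontrivialNonPowWeight] at hχ
    split_ifs at hχ
    · exact absurd rfl hχ
    · exact nonPowWeight_support hχ

end Sieve

/-- A sieve for consecutive elements that are not `l`-th powers for any prime `l` in a given
set. -/
theorem exists_consecutive_nonPow {F : Type*} [Field F] [Fintype F]
    (hF : Fintype.card F % 4 = 3) (hF7 : 7 ≤ Fintype.card F) {n s : ℕ} (hn : 2 ≤ n)
    (hnF : n < Fintype.card F) (hinj : Function.Injective fun k : Fin n ↦ ((k : ℕ) : F))
    {S : Finset ℕ} (hS : ∀ l ∈ S, l.Prime) (hSF : ∀ l ∈ S, l ∣ Fintype.card F - 1) (h2 : 2 ∈ S)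
    {p : Fin s → ℕ} (hp : ∀ i, (p i).Prime) (hpF : ∀ i, p i ∣ Fintype.card F - 1)
    (hpS : ∀ i, p i ∉ S) {δ : ℝ} (hδ : δ = 1 - n * ∑ i, 1 / (p i : ℝ)) (hδ0 : 0 < δ)
    (hbound : ((n : ℝ) - 1) / 2 * ((n * s - 1) / δ + 2) * (2 ^ #S) ^ n < √(Fintype.card F)) :
    ∃ x : F, ∀ k : Fin n, x + (k : ℕ) ≠ 0 ∧ (∀ l ∈ S, ¬ ∃ y, y ^ l = x + (k : ℕ)) ∧
      ∀ i, ¬ ∃ y, y ^ p i = x + (k : ℕ) := by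
  classical
  let _ : Fintype (MulChar F ℂ) := Fintype.ofFinite _
  obtain ⟨η, hη1, hη2, hη⟩ := exists_mulChar_neg_one_eq_neg_one hF
  obtain ⟨w, hw, hw0, hw1, hwB, hwS, hwη⟩ := exists_nonPow_weight S hS hSF
  set θ := ∏ l ∈ S, (1 - 1 / (l : ℝ)) with hθ
  have hθ0 : 0 < θ := Finset.prod_pos fun l hl ↦ by
    rw [sub_pos, div_lt_one (by exact_mod_cast (hS l hl).pos)]
    exact_mod_cast (hS l hl).one_lt
  have hwz := sum_norm_mul_re_eq_zero hη (hwη h2 η hη1 hη2)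
  let D (i : Fin s) := ∑ j, shiftSum
    (Function.update (fun _ : Fin n ↦ w) j (charConv (nontrivialNonPowWeight F (p i)) w))
  let N := shiftSum fun _ : Fin n ↦ w
  set R := (n - 1 : ℝ) / 2 * √(Fintype.card F) * (2 ^ #S * θ) ^ n with hR
  have hD (i : Fin s) : ‖D i‖ ≤ n * (1 - 1 / (p i : ℝ)) * R :=
    norm_sum_shiftSum_update_le hn hnF (by omega) hinj hwz
      (charConv_nontrivialNonPowWeight_one (Nat.Coprime.prod_right fun l hl ↦
        (Nat.coprime_primes (hp i) (hS l hl)).mpr (by rintro h; exact hpS i (h ▸ hl))) hwS)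
      hwB (sum_norm_nontrivialNonPowWeight (hp i).pos (hpF i)).le
  have hN : ‖N - (Fintype.card F * θ ^ n : ℝ)‖ ≤ R := by
    have h := norm_shiftSum_add_rev_sub_le hn hnF (by omega) hinj (w := fun _ ↦ w)
      ⟨⟨0, by omega⟩, hwz⟩ (B := (2 ^ #S * θ) ^ n) (by
        rw [Finset.prod_const, Finset.card_univ, Fintype.card_fin]
        exact pow_le_pow_left₀ (by positivity) hwB n)
    rw [Finset.prod_const, Finset.card_univ, Fintype.card_fin, hw1] at h
    have h3 : N + N - 2 * Fintype.card F * (θ : ℂ) ^ n =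
        2 * (N - (Fintype.card F * θ ^ n : ℝ)) := by
      push_cast
      ring
    change ‖N + N - _‖ ≤ _ at h
    rw [h3, norm_mul, Complex.norm_ofNat] at h
    rw [hR]
    linarith
  by_contra! hno
  have hterm (x : F) : ∃ t : ℝ, t ≤ 0 ∧ (∏ k : Fin n, charSum w (x + (k : ℕ))) *
      (δ + ∑ i, ∑ j : Fin n, charSum (nontrivialNonPowWeight F (p i)) (x + (j : ℕ))) = t := by
    by_cases hx : ∀ k : Fin n, x + (k : ℕ) ≠ 0 ∧ ∀ l ∈ S, ¬ ∃ y, y ^ l = x + (k : ℕ)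
    · refine ⟨δ + ∑ i, ∑ j : Fin n,
        (1 / p i - (if ∃ y, y ^ p i = x + (j : ℕ) then 1 else 0) : ℝ), ?_, ?_⟩
      · obtain ⟨k, hk⟩ := hno x
        obtain ⟨i, hi⟩ := hk (hx k).1 (by simpa using (hx k).2)
        have h1 : (1 : ℝ) ≤ ∑ i, ∑ j : Fin n, if ∃ y, y ^ p i = x + (j : ℕ) then 1 else 0 := by
          calc (1 : ℝ) = if ∃ y, y ^ p i = x + (k : ℕ) then 1 else 0 := (if_pos hi).symm
            _ ≤ ∑ j : Fin n, if ∃ y, y ^ p i = x + (j : ℕ) then 1 else 0 :=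
              Finset.single_le_sum (f := fun j : Fin n ↦
                if ∃ y, y ^ p i = x + (j : ℕ) then (1 : ℝ) else 0)
                (fun j _ ↦ by positivity) (Finset.mem_univ k)
            _ ≤ _ := Finset.single_le_sum (f := fun i ↦ ∑ j : Fin n,
                if ∃ y, y ^ p i = x + (j : ℕ) then (1 : ℝ) else 0)
                (fun i _ ↦ by positivity) (Finset.mem_univ i)
        simp only [Finset.sum_sub_distrib, Finset.sum_const, Finset.card_univ, Fintype.card_fin,
          nsmul_eq_mul, ← Finset.mul_sum]
        linarith
      · rw [Finset.prod_eq_one fun k _ ↦ by rw [hw _ (hx k).1, if_pos (hx k).2], one_mul]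
        push_cast
        congr 1
        refine Finset.sum_congr rfl fun i _ ↦ Finset.sum_congr rfl fun j _ ↦ ?_
        rw [charSum_nontrivialNonPowWeight (hp i).pos (hpF i) (hx j).1]
        push_cast
        rfl
    · push Not at hx
      obtain ⟨k, hk⟩ := hx
      refine ⟨0, le_rfl, ?_⟩
      rw [Finset.prod_eq_zero (Finset.mem_univ k), zero_mul, Complex.ofReal_zero]
      by_cases h0 : x + (k : ℕ) = 0
      · rw [h0, hw0]
      · rw [hw _ h0, if_neg]
        intro h
        obtain ⟨l, hl, y, hy⟩ := hk h0
        exact h l hl ⟨y, hy⟩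
  choose t ht0 ht using hterm
  have htot : δ * N + ∑ i, D i = ((∑ x, t x : ℝ) : ℂ) := by
    push_cast
    simp only [N, D, shiftSum_update, ← ht]
    simp only [shiftSum, Finset.mul_sum, mul_add, Finset.sum_add_distrib]
    congr 1
    · exact Finset.sum_congr rfl fun x _ ↦ mul_comm _ _
    · rw [Finset.sum_congr rfl fun i _ ↦ Finset.sum_comm, Finset.sum_comm]
  have hre : δ * N.re + ∑ i, (D i).re ≤ 0 := by
    have h := congrArg Complex.re htot
    rw [Complex.add_re, Complex.re_ofReal_mul, Complex.re_sum, Complex.ofReal_re] at h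
    rw [h]
    exact Finset.sum_nonpos fun x _ ↦ ht0 x
  have hN' : Fintype.card F * θ ^ n - R ≤ N.re := by
    have h := (Complex.abs_re_le_norm _).trans hN
    rw [Complex.sub_re, Complex.ofReal_re, abs_le] at h
    linarith
  have hD' : -((n * s - 1 + δ) * R) ≤ ∑ i, (D i).re := by
    calc -((n * s - 1 + δ) * R) = ∑ i, -(n * (1 - 1 / (p i : ℝ)) * R) := by
          rw [Finset.sum_neg_distrib, ← Finset.sum_mul, ← Finset.mul_sum, Finset.sum_sub_distrib,
            hδ]
          simp only [Finset.sum_const, Finset.card_univ, Fintype.card_fin, nsmul_eq_mul]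
          ring
      _ ≤ _ := Finset.sum_le_sum fun i _ ↦
          (abs_le.mp ((Complex.abs_re_le_norm _).trans (hD i))).1
  have hq0 : 0 < √(Fintype.card F : ℝ) := Real.sqrt_pos.mpr (by exact_mod_cast Fintype.card_pos)
  have hmain : δ * R * ((n * s - 1) / δ + 2) < δ * (Fintype.card F * θ ^ n) := by
    calc δ * R * ((n * s - 1) / δ + 2) = δ * θ ^ n * √(Fintype.card F) *
        (((n : ℝ) - 1) / 2 * ((n * s - 1) / δ + 2) * (2 ^ #S) ^ n) := by
          rw [hR, mul_pow]
          ring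
      _ < δ * θ ^ n * √(Fintype.card F) * √(Fintype.card F) :=
          mul_lt_mul_of_pos_left hbound (by positivity)
      _ = _ := by
          rw [mul_assoc, Real.mul_self_sqrt (by positivity)]
          ring
  have hsplit : δ * R * ((n * s - 1) / δ + 2) = (n * s - 1 + 2 * δ) * R := by
    field_simp
  have := mul_le_mul_of_nonneg_left hN' hδ0.le
  linarith

lemma isPrimitiveElem_of_forall_not_pow {F : Type*} [Field F] [Fintype F] {g : F} (hg : g ≠ 0)
    (h : ∀ l : ℕ, l.Prime → l ∣ Fintype.card F - 1 → ¬ ∃ y, y ^ l = g) : IsPrimitiveElem g := by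
  classical
  set u : Fˣ := Units.mk0 g hg with hu
  have hcard : Nat.card Fˣ = Fintype.card F - 1 := by
    rw [Nat.card_eq_fintype_card, Fintype.card_units]
  have hord : orderOf u = Nat.card Fˣ := by
    by_contra hne
    obtain ⟨d, hd⟩ := orderOf_dvd_natCard u
    have hd1 : d ≠ 1 := by
      rintro rfl
      exact hne (by rw [hd, mul_one])
    obtain ⟨l, hl, m, rfl⟩ := Nat.exists_prime_and_dvd hd1
    have hG : Nat.card Fˣ = l * (orderOf u * m) := by rw [hd]; ring
    have hpos : 0 < orderOf u * m :=
      Nat.pos_of_mul_pos_left (hG ▸ Nat.card_pos)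
    obtain ⟨y, hy⟩ := exists_pow_eq_of_pow_eq_one hpos hG
      (u := u) (by rw [pow_mul, pow_orderOf_eq_one, one_pow])
    exact h l hl ⟨_, hcard ▸ hG⟩ ⟨y, by rw [← Units.val_pow_eq_pow_val, ← hy, hu, Units.val_mk0]⟩
  intro x hx
  have htop := Subgroup.eq_top_of_card_eq (Subgroup.zpowers u) (by rw [Nat.card_zpowers, hord])
  obtain ⟨k, hk⟩ := mem_powers_iff_mem_zpowers.mpr (htop ▸ Subgroup.mem_top (Units.mk0 x hx))
  exact ⟨k, by simpa [hu] using congrArg Units.val hk⟩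

/-- Sieving criterion for `q ≡ 3 (mod 4)`, `q ≥ 7`: let `e` be an even divisor of `q-1`
and let `p₁, …, p_s` be the distinct primes dividing `q-1` but not `e` (so `s = 0` and
`δ = 1` when `Rad(e) = Rad(q-1)`), and set `δ = 1 - n ∑ᵢ 1/pᵢ`. If `δ > 0` and
`q > (((n-1)/2)((ns-1)/δ + 2) W(e)ⁿ)²`, then `𝔽_q` contains `n` consecutive primitive
elements. -/
theorem consecutive_primitives_of_sieve_three_mod_four (q c n s : ℕ) (hq : IsPrimePow q)
    (hq4 : q % 4 = 3) (hq7 : 7 ≤ q)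
    (F : Type*) [Field F] [Fintype F] (hF : Fintype.card F = q) (hc : CharP F c)
    (hn3 : 3 ≤ n) (hnc : n ≤ c) (e : ℕ) (he : e ∣ q - 1) (heven : Even e)
    (p : Fin s → ℕ) (hprime : ∀ i, (p i).Prime) (hdvd : ∀ i, p i ∣ q - 1)
    (hnot : ∀ i, ¬ p i ∣ e) (hinj : Function.Injective p)
    (hall : ∀ r : ℕ, r.Prime → r ∣ q - 1 → ¬ r ∣ e → ∃ i, p i = r)
    (δ : ℝ) (hδdef : δ = 1 - (n : ℝ) * ∑ i : Fin s, 1 / (p i : ℝ)) (hδ : 0 < δ)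
    (hbound : (q : ℝ) >
      ((((n : ℝ) - 1) / 2) * (((n : ℝ) * s - 1) / δ + 2) * (W e : ℝ) ^ n) ^ 2) :
    HasConsecutivePrimitives F n := by
  subst hF
  have hFc : n ≤ Fintype.card F := hnc.trans (Nat.le_of_dvd Fintype.card_pos
    ((CharP.cast_eq_zero_iff F c _).mp (Nat.cast_card_eq_zero F)))
  have hc0 (i j : ℕ) (hi : i < n) (hj : j < n) (h : (i : F) = j) : i = j :=
    CharP.natCast_injOn_Iio F c (Set.mem_Iio.mpr (hi.trans_le hnc))
      (Set.mem_Iio.mpr (hj.trans_le hnc)) h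
  have he0 : e ≠ 0 := by
    rintro rfl
    have := zero_dvd_iff.mp he
    omega
  have h2 : 2 ∈ e.primeFactors :=
    Nat.mem_primeFactors.mpr ⟨Nat.prime_two, heven.two_dvd, he0⟩
  have hn : (3 : ℝ) ≤ n := by exact_mod_cast hn3
  have hfactor : 1 ≤ ((n : ℝ) * s - 1) / δ + 2 := by
    rcases Nat.eq_zero_or_pos s with rfl | hs
    · simp at hδdef
      rw [hδdef]
      norm_num
    · have hs1 : (1 : ℝ) ≤ s := by exact_mod_cast hs
      have : 0 ≤ ((n : ℝ) * s - 1) / δ := div_nonneg (by nlinarith) hδ.le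
      linarith
  set X := (((n : ℝ) - 1) / 2) * (((n : ℝ) * s - 1) / δ + 2) * (W e : ℝ) ^ n with hX
  have hWn : (n : ℝ) ≤ (W e : ℝ) ^ n := by
    have h1 : (2 : ℝ) ≤ W e := by
      have : 2 ≤ W e := by
        rw [W]
        exact Nat.le_self_pow (Finset.card_pos.mpr ⟨2, h2⟩).ne' 2
      exact_mod_cast this
    calc (n : ℝ) ≤ 2 ^ n := by exact_mod_cast Nat.lt_two_pow_self.le
      _ ≤ _ := pow_le_pow_left₀ (by norm_num) h1 n
  have hnX : (n : ℝ) ≤ X := by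
    have h1 : 1 ≤ (((n : ℝ) - 1) / 2) * (((n : ℝ) * s - 1) / δ + 2) := by nlinarith
    nlinarith
  have hnF : n < Fintype.card F := by
    have : (n : ℝ) < Fintype.card F := by nlinarith
    exact_mod_cast this
  obtain ⟨x, hx⟩ := exists_consecutive_nonPow hq4 hq7 (by omega) hnF
    (fun i j h ↦ Fin.ext (hc0 i j i.isLt j.isLt h))
    (fun l hl ↦ Nat.prime_of_mem_primeFactors hl)
    (fun l hl ↦ (Nat.dvd_of_mem_primeFactors hl).trans he) h2 hprime hdvd
    (fun i hi ↦ hnot i (Nat.dvd_of_mem_primeFactors hi)) hδdef hδ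
    (by
      apply Real.lt_sqrt_of_sq_lt
      rw [hX, W] at hbound
      exact_mod_cast hbound)
  refine ⟨x, fun k hk ↦ ?_, fun i hi j hj h ↦ hc0 i j hi hj (add_left_cancel h)⟩
  obtain ⟨h0, h1, h3⟩ := hx ⟨k, hk⟩
  refine isPrimitiveElem_of_forall_not_pow h0 fun l hl hlF ↦ ?_
  by_cases hle : l ∣ e
  · exact h1 l (Nat.mem_primeFactors.mpr ⟨hl, hle, he0⟩)
  · obtain ⟨i, rfl⟩ := hall l hl hlF hle
    exact h3 i
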